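/- arXiv:0909.4184 — 3 statements merged into one kernel-verified Lean document; each statement's English description precedes it below -/
import Mathlib

section
/- Let (B,λ) and (F,τ) be Lefschetz algebras, and let E be an ℕ-graded Artinian ℝ-algebra with graded algebra homomorphisms π : B → E and ι : E → F such that E is a free B-module via π and ι is surjective with kernel B⁺·E. Then for any x ∈ E^1 with ι(x) = τ, there exists t ∈ ℝ such that (E, π(λ) + t·x) is a Lefschetz algebra. -/
/-- `l` is a (strong) Lefschetz element for the graded algebra `𝒜` with top degree `r`. -/
def IsLefschetzElem {R : Type*} [CommRing R] [Algebra ℝ R]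
    (𝒜 : ℕ → Submodule ℝ R) (r : ℕ) (l : R) : Prop :=
  l ∈ 𝒜 1 ∧ ∀ i : ℕ, i ≤ r / 2 →
    (∀ w ∈ 𝒜 i, l ^ (r - 2 * i) * w = 0 → w = 0) ∧
      Submodule.map (LinearMap.mulLeft ℝ (l ^ (r - 2 * i))) (𝒜 i) = 𝒜 (r - i)

/-- ℕ-graded Artinian ℝ-algebra conditions with top degree `r`. -/
def IsGradedArtinian (R : Type*) [CommRing R] [Algebra ℝ R]
    (𝒜 : ℕ → Submodule ℝ R) (r : ℕ) [GradedAlgebra 𝒜] : Prop :=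
  FiniteDimensional ℝ R ∧ 𝒜 0 = Submodule.span ℝ {1} ∧ 𝒜 r ≠ ⊥ ∧ ∀ i, r < i → 𝒜 i = ⊥

section GradedOps

/-- the degree-wise scaling operator. -/
noncomputable def gop {R : Type*} [CommRing R] [Algebra ℝ R]
    (𝒜 : ℕ → Submodule ℝ R) [GradedAlgebra 𝒜] (r : ℕ) (c : ℕ → ℝ) : Module.End ℝ R :=
  ∑ i ∈ Finset.range (r + 1), c i • GradedAlgebra.proj 𝒜 i

variable {R : Type*} [CommRing R] [Algebra ℝ R] (𝒜 : ℕ → Submodule ℝ R) [GradedAlgebra 𝒜]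

theorem graded_ext {M : Type*} [AddCommGroup M] [Module ℝ M] {f g : R →ₗ[ℝ] M}
    (h : ∀ i, ∀ w ∈ 𝒜 i, f w = g w) : f = g := by
  ext w
  induction w using DirectSum.Decomposition.inductionOn 𝒜 with
  | zero => simp
  | homogeneous m => exact h _ _ m.2
  | add a b ha hb => rw [map_add, map_add, ha, hb]

theorem gproj_same {i : ℕ} {w : R} (hw : w ∈ 𝒜 i) : GradedAlgebra.proj 𝒜 i w = w := by
  rw [GradedAlgebra.proj_apply, DirectSum.decompose_of_mem_same _ hw]

theorem gproj_ne {i j : ℕ} {w : R} (hw : w ∈ 𝒜 i) (hij : i ≠ j) :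
    GradedAlgebra.proj 𝒜 j w = 0 := by
  rw [GradedAlgebra.proj_apply, DirectSum.decompose_of_mem_ne _ hw hij]

theorem gproj_mem (i : ℕ) (w : R) : GradedAlgebra.proj 𝒜 i w ∈ 𝒜 i := by
  rw [GradedAlgebra.proj_apply]; exact SetLike.coe_mem _

theorem gop_apply {r : ℕ} (hr : ∀ i, r < i → 𝒜 i = ⊥) (c : ℕ → ℝ) {i : ℕ} {w : R}
    (hw : w ∈ 𝒜 i) : gop 𝒜 r c w = c i • w := by
  by_cases hi : r < i
  · rw [hr i hi, Submodule.mem_bot] at hw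
    simp [hw]
  · simp only [gop, LinearMap.sum_apply, LinearMap.smul_apply]
    rw [Finset.sum_eq_single i]
    · rw [gproj_same 𝒜 hw]
    · intro j _ hj
      rw [gproj_ne 𝒜 hw hj.symm, smul_zero]
    · intro h; simp at h; omega

/-- degree operator -/
noncomputable def eul {R : Type*} [CommRing R] [Algebra ℝ R]
    (𝒜 : ℕ → Submodule ℝ R) [GradedAlgebra 𝒜] (r : ℕ) : Module.End ℝ R :=
  gop 𝒜 r (fun i => (i : ℝ))

theorem eul_apply {r : ℕ} (hr : ∀ i, r < i → 𝒜 i = ⊥) {i : ℕ} {w : R}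
    (hw : w ∈ 𝒜 i) : eul 𝒜 r w = (i : ℝ) • w := gop_apply 𝒜 hr _ hw

theorem gproj_eul {r : ℕ} (hr : ∀ i, r < i → 𝒜 i = ⊥) (j : ℕ) (w : R) :
    GradedAlgebra.proj 𝒜 j (eul 𝒜 r w) = (j : ℝ) • GradedAlgebra.proj 𝒜 j w := by
  have : (GradedAlgebra.proj 𝒜 j) ∘ₗ (eul 𝒜 r) = (j : ℝ) • GradedAlgebra.proj 𝒜 j := by
    apply graded_ext 𝒜
    intro i w hw
    rw [LinearMap.comp_apply, eul_apply 𝒜 hr hw, LinearMap.smul_apply, map_smul]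
    by_cases h : i = j
    · rw [h]
    · rw [gproj_ne 𝒜 hw h]; simp
  exact LinearMap.congr_fun this w

theorem eq_zero_of_gproj {w : R} (h : ∀ j, GradedAlgebra.proj 𝒜 j w = 0) : w = 0 := by
  classical
  rw [← DirectSum.sum_support_decompose 𝒜 w]
  apply Finset.sum_eq_zero
  intro i _
  exact h i

theorem gproj_eig {r : ℕ} (hr : ∀ i, r < i → 𝒜 i = ⊥) {a : ℝ} {w : R}
    (h : eul 𝒜 r w = a • w) {j : ℕ} (hj : (j : ℝ) ≠ a) : GradedAlgebra.proj 𝒜 j w = 0 := by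
  have h1 := gproj_eul 𝒜 hr j w
  rw [h, map_smul] at h1
  have h2 : ((j : ℝ) - a) • GradedAlgebra.proj 𝒜 j w = 0 := by rw [sub_smul, h1, sub_self]
  rcases smul_eq_zero.1 h2 with h3 | h3
  · exact absurd (sub_eq_zero.1 h3) hj
  · exact h3

theorem eig_zero {r : ℕ} (hr : ∀ i, r < i → 𝒜 i = ⊥) {a : ℝ} {w : R}
    (h : eul 𝒜 r w = a • w) (ha : ∀ j : ℕ, j ≤ r → (j : ℝ) ≠ a) : w = 0 := by
  apply eq_zero_of_gproj 𝒜
  intro j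
  by_cases hj : j ≤ r
  · exact gproj_eig 𝒜 hr h (ha j hj)
  · have := gproj_mem 𝒜 j w
    rwa [hr j (by omega), Submodule.mem_bot] at this

theorem mem_of_eig {r : ℕ} (hr : ∀ i, r < i → 𝒜 i = ⊥) {i : ℕ} {w : R}
    (h : eul 𝒜 r w = (i : ℝ) • w) : w ∈ 𝒜 i := by
  have : w - GradedAlgebra.proj 𝒜 i w = 0 := by
    apply eq_zero_of_gproj 𝒜
    intro j
    rw [map_sub]
    by_cases hj : j = i
    · subst hj
      rw [gproj_same 𝒜 (gproj_mem 𝒜 j w), sub_self]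
    · rw [gproj_eig 𝒜 hr h (by exact_mod_cast hj), gproj_ne 𝒜 (gproj_mem 𝒜 i w) (Ne.symm hj), sub_zero]
  rw [sub_eq_zero.1 this]
  exact gproj_mem 𝒜 i w

theorem mul_deg {i j : ℕ} {a w : R} (ha : a ∈ 𝒜 i) (hw : w ∈ 𝒜 j) : a * w ∈ 𝒜 (i + j) :=
  SetLike.GradedMul.mul_mem ha hw

theorem pow_mul_deg {l : R} (hl : l ∈ 𝒜 1) (k : ℕ) {j : ℕ} {w : R} (hw : w ∈ 𝒜 j) :
    l ^ k * w ∈ 𝒜 (j + k) := by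
  have h : l ^ k ∈ 𝒜 k := by simpa using SetLike.pow_mem_graded k hl
  rw [add_comm]; exact mul_deg 𝒜 h hw

theorem eul_mul {r : ℕ} (hr : ∀ i, r < i → 𝒜 i = ⊥) {l : R} (hl : l ∈ 𝒜 1) :
    eul 𝒜 r * LinearMap.mulLeft ℝ l = LinearMap.mulLeft ℝ l * eul 𝒜 r + LinearMap.mulLeft ℝ l := by
  apply graded_ext 𝒜
  intro i w hw
  simp only [Module.End.mul_apply, LinearMap.add_apply, LinearMap.mulLeft_apply]
  rw [eul_apply 𝒜 hr hw, eul_apply 𝒜 hr (mul_deg 𝒜 hl hw)]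
  rw [mul_smul_comm]; push_cast; module

end GradedOps

section Trace

variable {W : Type*} [AddCommGroup W] [Module ℝ W] [FiniteDimensional ℝ W]

theorem end_eq_zero_of_trace (Z : Module.End ℝ W)
    (h : ∀ Y : Module.End ℝ W, LinearMap.trace ℝ W (Z * Y) = 0) : Z = 0 := by
  classical
  let bs := Module.finBasis ℝ W
  have : LinearMap.toMatrixAlgEquiv bs Z = 0 := by
    rw [Matrix.ext_iff_trace_mul_right]
    intro x
    have h1 := h ((LinearMap.toMatrixAlgEquiv bs).symm x)
    rw [LinearMap.trace_eq_matrix_trace ℝ bs] at h1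
    change Matrix.trace (LinearMap.toMatrixAlgEquiv bs _) = 0 at h1
    rw [map_mul] at h1
    simpa using h1
  simpa using this

theorem mem_range_ad (L H : Module.End ℝ W)
    (h : ∀ Z : Module.End ℝ W, Z * L = L * Z → LinearMap.trace ℝ W (Z * H) = 0) :
    ∃ Y : Module.End ℝ W, L * Y - Y * L = H := by
  let ad : Module.End ℝ W →ₗ[ℝ] Module.End ℝ W := LinearMap.mulLeft ℝ L - LinearMap.mulRight ℝ L
  by_contra hc
  have hH : H ∉ LinearMap.range ad := by
    rintro ⟨Y, hY⟩
    exact hc ⟨Y, by simpa [ad] using hY⟩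
  obtain ⟨g, hg, hg0⟩ := Submodule.exists_dual_map_eq_bot_of_notMem hH inferInstance
  let T : Module.End ℝ W →ₗ[ℝ] Module.Dual ℝ (Module.End ℝ W) :=
    (LinearMap.mul ℝ (Module.End ℝ W)).compr₂ (LinearMap.trace ℝ W)
  have hT : Function.Injective T := by
    rw [injective_iff_map_eq_zero]
    intro Z hZ
    apply end_eq_zero_of_trace
    intro Y
    exact LinearMap.congr_fun hZ Y
  have hs : Function.Surjective T :=
    (LinearMap.injective_iff_surjective_of_finrank_eq_finrank
      (Subspace.dual_finrank_eq).symm).1 hT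
  obtain ⟨Z, rfl⟩ := hs g
  apply hg
  apply h
  rw [← sub_eq_zero]
  apply end_eq_zero_of_trace
  intro Y
  have h1 : T Z (ad Y) = 0 := by
    have : T Z (ad Y) ∈ Submodule.map (T Z) (LinearMap.range ad) :=
      ⟨_, ⟨Y, rfl⟩, rfl⟩
    rwa [hg0, Submodule.mem_bot] at this
  have h2 : LinearMap.trace ℝ W (Z * (L * Y - Y * L)) = 0 := by simpa [T, ad] using h1
  rw [mul_sub, map_sub] at h2
  rw [sub_mul, map_sub, ← h2, mul_assoc, mul_assoc, LinearMap.trace_mul_comm ℝ L, mul_assoc]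

end Trace

section SL2

variable {W : Type*} [AddCommGroup W] [Module ℝ W]

theorem eig_pow {Eu U : Module.End ℝ W} {s : ℝ} (hU : Eu * U = U * Eu + s • U) {a : ℝ} {w : W}
    (hw : Eu w = a • w) (k : ℕ) : Eu ((U ^ k) w) = (a + k * s) • (U ^ k) w := by
  induction k with
  | zero => simpa using hw
  | succ k ih =>
    rw [pow_succ', Module.End.mul_apply]
    have := LinearMap.congr_fun hU ((U ^ k) w)
    simp only [Module.End.mul_apply, LinearMap.add_apply, LinearMap.smul_apply] at this
    rw [this, ih, map_smul]; push_cast; module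

theorem sl2_prim {Eu U V : Module.End ℝ W} {d : ℝ} (hU : Eu * U = U * Eu + (1 : ℝ) • U)
    (hUV : U * V - V * U = (2 : ℝ) • Eu - d • 1) {a : ℝ} {w : W}
    (hw : Eu w = a • w) (hV : V w = 0) (k : ℕ) :
    V ((U ^ (k + 1)) w) = ((k + 1) * (d - 2 * a - k)) • (U ^ k) w := by
  induction k with
  | zero =>
    have := LinearMap.congr_fun hUV w
    simp only [Module.End.mul_apply, LinearMap.sub_apply, LinearMap.smul_apply, hV, map_zero, hw,
      Module.End.one_apply, zero_sub] at this
    simp only [zero_add, pow_one, pow_zero, Module.End.one_apply]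
    rw [← neg_neg (V (U w)), this]; push_cast; module
  | succ k ih =>
    have h1 := LinearMap.congr_fun hUV ((U ^ (k + 1)) w)
    simp only [Module.End.mul_apply, LinearMap.sub_apply, LinearMap.smul_apply, 
      Module.End.one_apply] at h1
    rw [eig_pow hU hw, ih, map_smul, ← Module.End.mul_apply U (U ^ k), ← pow_succ'] at h1
    rw [pow_succ' U (k + 1), Module.End.mul_apply]
    rw [sub_eq_iff_eq_add, ← sub_eq_iff_eq_add'] at h1
    rw [← h1]; push_cast; module

theorem sl2_comm {Eu U V : Module.End ℝ W} {d : ℝ} (hU : Eu * U = U * Eu + (1 : ℝ) • U)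
    (hUV : U * V - V * U = (2 : ℝ) • Eu - d • 1) {a : ℝ} {w : W}
    (hw : Eu w = a • w) (k : ℕ) :
    (U ^ (k + 1)) (V w) = V ((U ^ (k + 1)) w) - ((k + 1) * (d - 2 * a - k)) • (U ^ k) w := by
  induction k with
  | zero =>
    have := LinearMap.congr_fun hUV w
    simp only [Module.End.mul_apply, LinearMap.sub_apply, LinearMap.smul_apply, hw,
      Module.End.one_apply] at this
    simp only [zero_add, pow_one, pow_zero, Module.End.one_apply]
    rw [sub_eq_iff_eq_add] at this
    rw [this]; push_cast; module
  | succ k ih =>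
    have h1 := LinearMap.congr_fun hUV ((U ^ (k + 1)) w)
    simp only [Module.End.mul_apply, LinearMap.sub_apply, LinearMap.smul_apply, 
      Module.End.one_apply] at h1
    rw [eig_pow hU hw] at h1
    rw [pow_succ' U (k + 1), Module.End.mul_apply, ih, map_sub, map_smul,
      ← Module.End.mul_apply U (U ^ k), ← pow_succ', Module.End.mul_apply]
    rw [sub_eq_iff_eq_add] at h1
    rw [h1]; push_cast; module

theorem sl2_inj_prim {Eu U V : Module.End ℝ W} {d : ℝ} (hU : Eu * U = U * Eu + (1 : ℝ) • U)
    (hUV : U * V - V * U = (2 : ℝ) • Eu - d • 1) {a : ℝ} {w : W}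
    (hw : Eu w = a • w) (hV : V w = 0) (N : ℕ) (hN : d - 2 * a = N) (k : ℕ) (hk : k ≤ N)
    (h : (U ^ k) w = 0) : w = 0 := by
  induction k with
  | zero => simpa using h
  | succ k ih =>
    apply ih (by omega)
    have h1 := sl2_prim hU hUV hw hV k
    rw [h, map_zero] at h1
    refine (smul_eq_zero.1 h1.symm).resolve_left ?_
    rw [hN]
    have h2 : (k : ℝ) + 1 ≤ N := by exact_mod_cast hk
    have h3 : (0 : ℝ) ≤ k := k.cast_nonneg
    have : (0 : ℝ) < (k + 1) * (N - k) := mul_pos (by linarith) (by linarith)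
    exact this.ne'

theorem sl2_inj {Eu U V : Module.End ℝ W} {d : ℝ} (hU : Eu * U = U * Eu + (1 : ℝ) • U)
    (hVE : Eu * V = V * Eu + (-1 : ℝ) • V)
    (hUV : U * V - V * U = (2 : ℝ) • Eu - d • 1) (r : ℕ) : ∀ {a : ℝ} {w : W}
    (_ : Eu w = a • w) (_ : (V ^ r) w = 0) (N : ℕ) (_ : d - 2 * a = N)
    (_ : (U ^ N) w = 0), w = 0 := by
  induction r with
  | zero => intro a w _ h; simp at h; simp [h]
  | succ r ih =>
    intro a w hw hr N hN h
    have hVw : V w = 0 := by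
      refine ih (a := a - 1) (w := V w) ?_ ?_ (N + 2) ?_ ?_
      · have := eig_pow hVE hw 1
        simp only [pow_one] at this
        rw [this]; push_cast; module
      · rw [← Module.End.mul_apply, ← pow_succ]; exact hr
      · push_cast; linarith
      · have h1 : (U ^ (N + 1)) w = 0 := by
          rw [pow_succ', Module.End.mul_apply, h, map_zero]
        rw [sl2_comm hU hUV hw, pow_succ' U (N + 1), Module.End.mul_apply, h1]
        simp
    exact sl2_inj_prim hU hUV hw hVw N hN N le_rfl h

end SL2

section Lowering

variable {R : Type*} [CommRing R] [Algebra ℝ R] (𝒜 : ℕ → Submodule ℝ R) [GradedAlgebra 𝒜]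

theorem lef_inverse {r : ℕ} {l : R} (hl : IsLefschetzElem 𝒜 r l) {i : ℕ} (hi : i ≤ r / 2) :
    ∃ M : Module.End ℝ R,
      M * LinearMap.mulLeft ℝ (l ^ (r - 2 * i)) = GradedAlgebra.proj 𝒜 i ∧
      LinearMap.mulLeft ℝ (l ^ (r - 2 * i)) * M = GradedAlgebra.proj 𝒜 (r - i) := by
  obtain ⟨hl1, hl2⟩ := hl
  obtain ⟨hinj, hmap⟩ := hl2 i hi
  set k := r - 2 * i with hk
  have hki : r - i = i + k := by omega
  let T : 𝒜 i →ₗ[ℝ] 𝒜 (r - i) := (LinearMap.mulLeft ℝ (l ^ k)).restrict (by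
    intro w hw
    rw [hki]
    exact pow_mul_deg 𝒜 hl1 k hw)
  have hTb : Function.Bijective T := by
    constructor
    · rw [injective_iff_map_eq_zero]
      intro w hw
      have := hinj w w.2 (congrArg Subtype.val hw)
      exact Subtype.ext this
    · intro y
      obtain ⟨w, hw, hwy⟩ := hmap.ge y.2
      exact ⟨⟨w, hw⟩, Subtype.ext hwy⟩
  let Te := LinearEquiv.ofBijective T hTb
  let pr : R →ₗ[ℝ] 𝒜 (r - i) := (GradedAlgebra.proj 𝒜 (r - i)).codRestrict _ (gproj_mem 𝒜 _)
  refine ⟨(𝒜 i).subtype ∘ₗ Te.symm.toLinearMap ∘ₗ pr, ?_, ?_⟩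
  · apply graded_ext 𝒜
    intro j w hw
    have hlw := pow_mul_deg 𝒜 hl1 k hw
    by_cases hj : j = i
    · subst hj
      rw [gproj_same 𝒜 hw]
      have : pr (l ^ k * w) = Te ⟨w, hw⟩ := by
        apply Subtype.ext
        change GradedAlgebra.proj 𝒜 (r - j) (l ^ k * w) = l ^ k * w
        rw [hki, gproj_same 𝒜 hlw]
      simp [Module.End.mul_apply, this]
    · rw [gproj_ne 𝒜 hw hj]
      have : pr (l ^ k * w) = 0 := by
        apply Subtype.ext
        change GradedAlgebra.proj 𝒜 (r - i) (l ^ k * w) = 0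
        rw [hki, gproj_ne 𝒜 hlw (by omega)]
      simp [Module.End.mul_apply, this]
  · ext w
    have h1 : ((Te (Te.symm (pr w)) : 𝒜 (r - i)) : R) = pr w := by rw [Te.apply_symm_apply]
    exact h1

theorem gop_sum_trace {r : ℕ} {l : R} (hl : IsLefschetzElem 𝒜 r l)
    (Z : Module.End ℝ R) (hZ : Z * LinearMap.mulLeft ℝ l = LinearMap.mulLeft ℝ l * Z) :
    LinearMap.trace ℝ R (Z * gop 𝒜 r (fun i => 2 * (i : ℝ) - r)) = 0 := by
  have hsym0 : ∀ i, i ≤ r / 2 → LinearMap.trace ℝ R (Z * GradedAlgebra.proj 𝒜 i)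
      = LinearMap.trace ℝ R (Z * GradedAlgebra.proj 𝒜 (r - i)) := by
    intro i hi
    obtain ⟨M, h1, h2⟩ := lef_inverse 𝒜 hl hi
    have hc : Commute Z (LinearMap.mulLeft ℝ (l ^ (r - 2 * i))) := by
      rw [← LinearMap.pow_mulLeft]
      exact Commute.pow_right hZ _
    rw [← h1, ← h2, ← mul_assoc, ← mul_assoc, hc.eq, mul_assoc _ Z, LinearMap.trace_mul_comm]
  have hsym : ∀ i, i ≤ r → LinearMap.trace ℝ R (Z * GradedAlgebra.proj 𝒜 (r - i))
      = LinearMap.trace ℝ R (Z * GradedAlgebra.proj 𝒜 i) := by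
    intro i hi
    by_cases h : i ≤ r / 2
    · exact (hsym0 i h).symm
    · rw [hsym0 (r - i) (by omega), show r - (r - i) = i by omega]
  rw [gop, Finset.mul_sum, map_sum]
  simp only [mul_smul_comm, map_smul, smul_eq_mul]
  set S := ∑ i ∈ Finset.range (r + 1), (2 * (i : ℝ) - r) *
    LinearMap.trace ℝ R (Z * GradedAlgebra.proj 𝒜 i) with hS
  have : S = -S := by
    conv_lhs => rw [hS, ← Finset.sum_range_reflect]
    rw [hS, ← Finset.sum_neg_distrib]
    apply Finset.sum_congr rfl
    intro i hi
    rw [Finset.mem_range] at hi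
    have h1 : r + 1 - 1 - i = r - i := by omega
    rw [h1, hsym i (by omega), Nat.cast_sub (by omega)]
    ring
  linarith

theorem exists_lowering {r : ℕ} (hA : IsGradedArtinian R 𝒜 r) {l : R}
    (hl : IsLefschetzElem 𝒜 r l) :
    ∃ V : Module.End ℝ R,
      eul 𝒜 r * V = V * eul 𝒜 r + (-1 : ℝ) • V ∧
      LinearMap.mulLeft ℝ l * V - V * LinearMap.mulLeft ℝ l = (2 : ℝ) • eul 𝒜 r - (r : ℝ) • 1 := by
  obtain ⟨hfd, -, -, hr⟩ := hA
  have hl1 := hl.1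
  obtain ⟨Y, hY⟩ := mem_range_ad (LinearMap.mulLeft ℝ l) (gop 𝒜 r (fun i => 2 * (i : ℝ) - r))
    (fun Z hZ => gop_sum_trace 𝒜 hl Z hZ)
  have hY' : ∀ i, ∀ w ∈ 𝒜 i, l * Y w - Y (l * w) = (2 * (i : ℝ) - r) • w := by
    intro i w hw
    have := LinearMap.congr_fun hY w
    rw [gop_apply 𝒜 hr _ hw] at this
    exact this
  let V : Module.End ℝ R := ∑ i ∈ Finset.range r,
    GradedAlgebra.proj 𝒜 i * Y * GradedAlgebra.proj 𝒜 (i + 1)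
  have hV0 : ∀ w ∈ 𝒜 0, V w = 0 := by
    intro w hw
    simp only [V, LinearMap.sum_apply, Module.End.mul_apply]
    apply Finset.sum_eq_zero
    intro i _
    rw [gproj_ne 𝒜 hw (by omega)]; simp
  have hV1 : ∀ i, ∀ w ∈ 𝒜 (i + 1), V w = GradedAlgebra.proj 𝒜 i (Y w) := by
    intro i w hw
    by_cases hi : r < i + 1
    · rw [hr _ hi, Submodule.mem_bot] at hw
      simp [hw]
    simp only [V, LinearMap.sum_apply, Module.End.mul_apply]
    rw [Finset.sum_eq_single i]
    · rw [gproj_same 𝒜 hw]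
    · intro j _ hj
      rw [gproj_ne 𝒜 hw (by omega)]; simp
    · intro h; simp at h; omega
  have hp0 : ∀ w, GradedAlgebra.proj 𝒜 0 (l * w) = 0 := by
    intro w
    have : GradedAlgebra.proj 𝒜 0 * LinearMap.mulLeft ℝ l = 0 := by
      apply graded_ext 𝒜
      intro i w hw
      exact gproj_ne 𝒜 (mul_deg 𝒜 hl1 hw) (by omega)
    exact LinearMap.congr_fun this w
  have hp1 : ∀ i w, GradedAlgebra.proj 𝒜 (i + 1) (l * w) = l * GradedAlgebra.proj 𝒜 i w := by
    intro i w
    have : GradedAlgebra.proj 𝒜 (i + 1) * LinearMap.mulLeft ℝ l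
        = LinearMap.mulLeft ℝ l * GradedAlgebra.proj 𝒜 i := by
      apply graded_ext 𝒜
      intro j w hw
      simp only [Module.End.mul_apply, LinearMap.mulLeft_apply]
      by_cases h : j = i
      · subst h
        rw [gproj_same 𝒜 hw, add_comm, gproj_same 𝒜 (mul_deg 𝒜 hl1 hw)]
      · rw [gproj_ne 𝒜 hw h, gproj_ne 𝒜 (mul_deg 𝒜 hl1 hw) (by omega), mul_zero]
    exact LinearMap.congr_fun this w
  refine ⟨V, ?_, ?_⟩
  · apply graded_ext 𝒜
    intro i w hw
    simp only [Module.End.mul_apply, LinearMap.add_apply, LinearMap.smul_apply]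
    rw [eul_apply 𝒜 hr hw, map_smul]
    cases i with
    | zero => rw [hV0 w hw]; simp
    | succ i =>
      rw [hV1 i w hw, eul_apply 𝒜 hr (gproj_mem 𝒜 i _)]
      push_cast; module
  · apply graded_ext 𝒜
    intro i w hw
    simp only [Module.End.mul_apply, LinearMap.sub_apply, LinearMap.smul_apply,
      LinearMap.mulLeft_apply, Module.End.one_apply]
    have hlw := mul_deg 𝒜 hl1 hw
    rw [add_comm] at hlw
    rw [eul_apply 𝒜 hr hw, hV1 i _ hlw, smul_smul, ← sub_smul]
    rw [← gproj_same 𝒜 (Submodule.smul_mem _ (2 * (i : ℝ) - r) hw), ← hY' i w hw]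
    rw [map_sub]
    congr 1
    cases i with
    | zero => rw [hV0 w hw, hp0, mul_zero]
    | succ i => rw [hV1 i w hw, hp1]

end Lowering

open scoped TensorProduct

section Fibration

variable {B E F : Type*}
    [CommRing B] [Algebra ℝ B] [CommRing E] [Algebra ℝ E] [CommRing F] [Algebra ℝ F]

/-- `b ⊗ φ ↦ π b * g φ`. -/
noncomputable def thetaMap (π : B →ₐ[ℝ] E) (g : F →ₗ[ℝ] E) : B ⊗[ℝ] F →ₗ[ℝ] E :=
  (LinearMap.mul' ℝ E) ∘ₗ (TensorProduct.map π.toLinearMap g)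

theorem thetaMap_tmul (π : B →ₐ[ℝ] E) (g : F →ₗ[ℝ] E) (b : B) (φ : F) :
    thetaMap π g (b ⊗ₜ φ) = π b * g φ := by
  simp [thetaMap]

theorem thetaMap_mul (π : B →ₐ[ℝ] E) (g : F →ₗ[ℝ] E) (c : B) (m : B ⊗[ℝ] F) :
    thetaMap π g (TensorProduct.map (LinearMap.mulLeft ℝ c) LinearMap.id m)
      = π c * thetaMap π g m := by
  induction m with
  | zero => simp
  | tmul b φ => simp [thetaMap_tmul, mul_assoc]
  | add a b ha hb => rw [map_add, map_add, map_add, ha, hb, mul_add]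

theorem exists_graded_section (ℰ : ℕ → Submodule ℝ E) (ℱ : ℕ → Submodule ℝ F)
    [GradedAlgebra ℰ] [GradedAlgebra ℱ] (f : ℕ) (hr : ∀ i, f < i → ℱ i = ⊥)
    (ι : E →ₐ[ℝ] F) (hι : ∀ i, (ℰ i).map ι.toLinearMap ≤ ℱ i)
    (hsurj : Function.Surjective ι) :
    ∃ σ : F →ₗ[ℝ] E, (∀ j, ∀ φ ∈ ℱ j, σ φ ∈ ℰ j) ∧ ∀ φ, ι (σ φ) = φ := by
  obtain ⟨σ0, hσ0⟩ := LinearMap.exists_rightInverse_of_surjective ι.toLinearMap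
    (LinearMap.range_eq_top.2 hsurj)
  have hcomp : ∀ j y, ι (GradedAlgebra.proj ℰ j y) = GradedAlgebra.proj ℱ j (ι y) := by
    intro j y
    have : ι.toLinearMap ∘ₗ GradedAlgebra.proj ℰ j = GradedAlgebra.proj ℱ j ∘ₗ ι.toLinearMap := by
      apply graded_ext ℰ
      intro i w hw
      have hw' : ι w ∈ ℱ i := hι i ⟨w, hw, rfl⟩
      simp only [LinearMap.comp_apply, AlgHom.toLinearMap_apply]
      by_cases h : i = j
      · subst h
        rw [gproj_same ℰ hw, gproj_same ℱ hw']
      · rw [gproj_ne ℰ hw h, gproj_ne ℱ hw' h, map_zero]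
    exact LinearMap.congr_fun this y
  let σ : F →ₗ[ℝ] E := ∑ j ∈ Finset.range (f + 1),
    GradedAlgebra.proj ℰ j ∘ₗ σ0 ∘ₗ GradedAlgebra.proj ℱ j
  have hσ : ∀ j, ∀ φ ∈ ℱ j, σ φ = GradedAlgebra.proj ℰ j (σ0 φ) := by
    intro j φ hφ
    by_cases hj : f < j
    · rw [hr j hj, Submodule.mem_bot] at hφ
      simp [hφ]
    simp only [σ, LinearMap.sum_apply, LinearMap.comp_apply]
    rw [Finset.sum_eq_single j]
    · rw [gproj_same ℱ hφ]
    · intro i _ hi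
      rw [gproj_ne ℱ hφ hi.symm]; simp
    · intro h; simp at h; omega
  refine ⟨σ, ?_, ?_⟩
  · intro j φ hφ
    rw [hσ j φ hφ]; exact gproj_mem ℰ _ _
  · have : ι.toLinearMap ∘ₗ σ = LinearMap.id := by
      apply graded_ext ℱ
      intro j φ hφ
      have h1 : ι (σ0 φ) = φ := LinearMap.congr_fun hσ0 φ
      simp only [LinearMap.comp_apply, AlgHom.toLinearMap_apply, LinearMap.id_apply]
      rw [hσ j φ hφ, hcomp, h1, gproj_same ℱ hφ]
    exact fun φ => LinearMap.congr_fun this φ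

theorem thetaMap_surjective (ℬ : ℕ → Submodule ℝ B) (ℰ : ℕ → Submodule ℝ E) (ℱ : ℕ → Submodule ℝ F)
    [GradedAlgebra ℬ] [GradedAlgebra ℰ] [GradedAlgebra ℱ]
    (π : B →ₐ[ℝ] E) (ι : E →ₐ[ℝ] F)
    (hπ : ∀ i, (ℬ i).map π.toLinearMap ≤ ℰ i)
    (hι : ∀ i, (ℰ i).map ι.toLinearMap ≤ ℱ i)
    (hker : RingHom.ker (ι : E →+* F) =
      Ideal.span (⇑π '' (⋃ i : ℕ, ⋃ _ : 0 < i, (ℬ i : Set B))))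
    (σ : F →ₗ[ℝ] E) (hσ : ∀ j, ∀ φ ∈ ℱ j, σ φ ∈ ℰ j) (hισ : ∀ φ, ι (σ φ) = φ) :
    Function.Surjective (thetaMap π σ) := by
  have hmul : ∀ c y, y ∈ LinearMap.range (thetaMap π σ) → π c * y ∈ LinearMap.range (thetaMap π σ) := by
    rintro c _ ⟨m, rfl⟩
    exact ⟨_, thetaMap_mul π σ c m⟩
  have key : ∀ n, ∀ y ∈ ℰ n, y ∈ LinearMap.range (thetaMap π σ) := by
    intro n
    induction n using Nat.strong_induction_on with
    | _ n ih =>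
      intro y hy
      have hJ : ∀ z ∈ Ideal.span (⇑π '' (⋃ i : ℕ, ⋃ _ : 0 < i, (ℬ i : Set B))),
          GradedAlgebra.proj ℰ n z ∈ LinearMap.range (thetaMap π σ) := by
        intro z hz
        induction hz using Submodule.closure_induction with
        | zero => rw [map_zero]; exact Submodule.zero_mem _
        | add a b _ _ ha hb => rw [map_add]; exact Submodule.add_mem _ ha hb
        | smul_mem r x hx =>
          obtain ⟨c, hc, rfl⟩ := hx
          simp only [Set.mem_iUnion] at hc
          obtain ⟨k, hk, hc⟩ := hc
          have hc' : π c ∈ ℰ k := hπ k ⟨c, hc, rfl⟩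
          rw [GradedAlgebra.proj_apply, smul_eq_mul]
          by_cases hkn : k ≤ n
          · rw [DirectSum.coe_decompose_mul_of_right_mem_of_le ℰ hc' hkn, mul_comm]
            exact hmul _ _ (ih (n - k) (by omega) _ (SetLike.coe_mem _))
          · rw [DirectSum.coe_decompose_mul_of_right_mem_of_not_le ℰ hc' hkn]
            exact Submodule.zero_mem _
      have hιy : ι y ∈ ℱ n := hι n ⟨y, hy, rfl⟩
      have hz : y - σ (ι y) ∈ RingHom.ker (ι : E →+* F) := by
        rw [RingHom.mem_ker]
        change ι (y - σ (ι y)) = 0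
        rw [map_sub, hισ, sub_self]
      rw [hker] at hz
      have h1 := hJ _ hz
      rw [gproj_same ℰ (Submodule.sub_mem _ hy (hσ n _ hιy))] at h1
      have h2 : σ (ι y) ∈ LinearMap.range (thetaMap π σ) := ⟨1 ⊗ₜ ι y, by rw [thetaMap_tmul]; simp⟩
      simpa using Submodule.add_mem _ h1 h2
  intro y
  change y ∈ LinearMap.range (thetaMap π σ)
  induction y using DirectSum.Decomposition.inductionOn ℰ with
  | zero => exact Submodule.zero_mem _
  | homogeneous m => exact key _ _ m.2
  | add a b ha hb => exact Submodule.add_mem _ ha hb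

theorem iota_pi (ℬ : ℕ → Submodule ℝ B) [GradedAlgebra ℬ]
    (hB0 : ℬ 0 = Submodule.span ℝ {1})
    (π : B →ₐ[ℝ] E) (ι : E →ₐ[ℝ] F)
    (hker : RingHom.ker (ι : E →+* F) =
      Ideal.span (⇑π '' (⋃ i : ℕ, ⋃ _ : 0 < i, (ℬ i : Set B)))) (c : B) :
    ∃ a : ℝ, ι (π c) = algebraMap ℝ F a := by
  induction c using DirectSum.Decomposition.inductionOn ℬ with
  | zero => exact ⟨0, by simp⟩
  | @homogeneous i m =>
    cases i with
    | zero =>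
      have := m.2
      obtain ⟨a, ha⟩ := Submodule.mem_span_singleton.1 (hB0.le m.2)
      refine ⟨a, ?_⟩
      rw [← ha]; simp [Algebra.algebraMap_eq_smul_one]
    | succ i =>
      refine ⟨0, ?_⟩
      have : π (m : B) ∈ RingHom.ker (ι : E →+* F) := by
        rw [hker]
        apply Ideal.subset_span
        refine ⟨m, ?_, rfl⟩
        simp only [Set.mem_iUnion]
        exact ⟨i + 1, Nat.succ_pos _, m.2⟩
      rw [map_zero]
      exact this
  | add a b ha hb =>
    obtain ⟨s, hs⟩ := ha
    obtain ⟨t, ht⟩ := hb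
    exact ⟨s + t, by rw [map_add, map_add, hs, ht, map_add]⟩

theorem finrank_le (ℬ : ℕ → Submodule ℝ B) [GradedAlgebra ℬ]
    [FiniteDimensional ℝ B] [FiniteDimensional ℝ E] 
    (hB0 : ℬ 0 = Submodule.span ℝ {1})
    (π : B →ₐ[ℝ] E) (ι : E →ₐ[ℝ] F)
    (hfree : @Module.Free B E _ _ (Module.compHom E π.toRingHom))
    (hsurj : Function.Surjective ι)
    (hker : RingHom.ker (ι : E →+* F) =
      Ideal.span (⇑π '' (⋃ i : ℕ, ⋃ _ : 0 < i, (ℬ i : Set B)))) :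
    Module.finrank ℝ B * Module.finrank ℝ F ≤ Module.finrank ℝ E := by
  let _ : Algebra B E := π.toRingHom.toAlgebra
  have : IsScalarTower ℝ B E := by
    refine IsScalarTower.of_algebraMap_eq ?_
    intro x
    exact (π.commutes x).symm
  have hf : Module.Free B E := hfree
  rcases subsingleton_or_nontrivial B with hs | hn
  · have : Module.finrank ℝ B = 0 := Module.finrank_zero_of_subsingleton
    simp [this]
  have : Module.Finite B E := Module.Finite.of_restrictScalars_finite ℝ B E
  rw [← Module.finrank_mul_finrank ℝ B E]
  apply Nat.mul_le_mul_left
  let v := Module.finBasis B E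
  have hspan : Submodule.span ℝ (Set.range (fun k => ι (v k))) = ⊤ := by
    rw [eq_top_iff]
    intro φ _
    obtain ⟨y, rfl⟩ := hsurj φ
    rw [← v.sum_repr y, map_sum]
    apply Submodule.sum_mem
    intro k _
    obtain ⟨a, ha⟩ := iota_pi ℬ hB0 π ι hker (v.repr y k)
    have : ι (v.repr y k • v k) = a • ι (v k) := by
      rw [Algebra.smul_def, map_mul]
      change ι (π _) * _ = _
      rw [ha, Algebra.smul_def]
    rw [this]
    exact Submodule.smul_mem _ _ (Submodule.subset_span ⟨k, rfl⟩)
  have h1 := finrank_range_le_card (R := ℝ) (fun k => ι (v k))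
  rw [Set.finrank, hspan, finrank_top] at h1
  simpa using h1

theorem thetaMap_bijective (ℬ : ℕ → Submodule ℝ B) (ℰ : ℕ → Submodule ℝ E) (ℱ : ℕ → Submodule ℝ F)
    [GradedAlgebra ℬ] [GradedAlgebra ℰ] [GradedAlgebra ℱ]
    [FiniteDimensional ℝ B] [FiniteDimensional ℝ E] [FiniteDimensional ℝ F]
    (hB0 : ℬ 0 = Submodule.span ℝ {1})
    (π : B →ₐ[ℝ] E) (ι : E →ₐ[ℝ] F)
    (hπ : ∀ i, (ℬ i).map π.toLinearMap ≤ ℰ i)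
    (hι : ∀ i, (ℰ i).map ι.toLinearMap ≤ ℱ i)
    (hfree : @Module.Free B E _ _ (Module.compHom E π.toRingHom))
    (hsurj : Function.Surjective ι)
    (hker : RingHom.ker (ι : E →+* F) =
      Ideal.span (⇑π '' (⋃ i : ℕ, ⋃ _ : 0 < i, (ℬ i : Set B))))
    (σ : F →ₗ[ℝ] E) (hσ : ∀ j, ∀ φ ∈ ℱ j, σ φ ∈ ℰ j) (hισ : ∀ φ, ι (σ φ) = φ) :
    Function.Bijective (thetaMap π σ) := by
  have hs := thetaMap_surjective ℬ ℰ ℱ π ι hπ hι hker σ hσ hισ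
  refine ⟨?_, hs⟩
  have h1 := finrank_le ℬ hB0 π ι hfree hsurj hker
  have h2 : Module.finrank ℝ (B ⊗[ℝ] F) = Module.finrank ℝ E := by
    apply le_antisymm
    · rw [Module.finrank_tensorProduct]; exact h1
    · exact LinearMap.finrank_le_finrank_of_surjective hs
  exact (LinearMap.injective_iff_surjective_of_finrank_eq_finrank h2).2 hs

end Fibration

section Openness

variable {W : Type*} [AddCommGroup W] [Module ℝ W] [FiniteDimensional ℝ W]

theorem eventually_inj (n : ℕ) (A0 : Module.End ℝ W) (Aj : ℕ → Module.End ℝ W)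
    (A : ℝ → Module.End ℝ W) (hA : ∀ t, A t = A0 + ∑ j ∈ Finset.range n, t ^ j • Aj j)
    (P : Submodule ℝ W) (N : ℕ) (hinj : ∀ w ∈ P, ((A 0) ^ N) w = 0 → w = 0) :
    ∀ᶠ t in nhds (0 : ℝ), ∀ w ∈ P, ((A t) ^ N) w = 0 → w = 0 := by
  classical
  let bs := Module.finBasis ℝ W
  let m := LinearMap.toMatrixAlgEquiv bs
  have hcont : Continuous (fun t => m (A t)) := by
    simp only [hA, map_add, map_sum, map_smul]
    fun_prop
  obtain ⟨g, hg⟩ := LinearMap.exists_leftInverse_of_injective (((A 0) ^ N).domRestrict P) (by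
    rw [LinearMap.ker_eq_bot, injective_iff_map_eq_zero]
    intro w hw
    exact Subtype.ext (hinj w w.2 hw))
  obtain ⟨q, hq⟩ := LinearMap.exists_leftInverse_of_injective P.subtype (by simp)
  let G : Module.End ℝ W := P.subtype ∘ₗ g
  let Q : Module.End ℝ W := P.subtype ∘ₗ q
  have hQ : ∀ w ∈ P, Q w = w := by
    intro w hw
    have := LinearMap.congr_fun hq ⟨w, hw⟩
    exact congrArg Subtype.val this
  have hG : ∀ w ∈ P, G (((A 0) ^ N) w) = w := by
    intro w hw
    have := LinearMap.congr_fun hg ⟨w, hw⟩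
    exact congrArg Subtype.val this
  let C : ℝ → Module.End ℝ W := fun t => G * (A t) ^ N * Q + (1 - Q)
  have hC0 : C 0 = 1 := by
    ext w
    have : G (((A 0) ^ N) (Q w)) = Q w := hG _ (q w).2
    simp [C, this]
  have hCc : Continuous (fun t => (m (C t)).det) := by
    apply Continuous.matrix_det
    simp only [C, map_add, map_mul, map_pow]
    exact ((continuous_const.mul (hcont.pow N)).mul continuous_const).add continuous_const
  have hne : ∀ᶠ t in nhds (0 : ℝ), (m (C t)).det ≠ 0 := by
    apply hCc.continuousAt.eventually_ne
    rw [hC0, map_one, Matrix.det_one]; exact one_ne_zero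
  filter_upwards [hne] with t ht w hw h
  have h1 : C t w = 0 := by
    simp [C, hQ w hw, h]
  have hu : IsUnit (m (C t)) := (Matrix.isUnit_iff_isUnit_det _).2 (isUnit_iff_ne_zero.2 ht)
  have hu2 : IsUnit (C t) := by simpa using hu.map m.symm
  obtain ⟨u, hu3⟩ := hu2
  have : (↑u⁻¹ : Module.End ℝ W) (C t w) = w := by
    rw [← hu3, ← Module.End.mul_apply, u.inv_mul, Module.End.one_apply]
  rw [← this, h1, map_zero]

theorem finrank_map_of_inj {W : Type*} [AddCommGroup W] [Module ℝ W] (T : Module.End ℝ W) (P : Submodule ℝ W)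
    (h : ∀ w ∈ P, T w = 0 → w = 0) : Module.finrank ℝ (P.map T) = Module.finrank ℝ P := by
  have hi : Function.Injective (T.domRestrict P) := by
    rw [injective_iff_map_eq_zero]
    intro w hw
    exact Subtype.ext (h w w.2 hw)
  rw [← LinearMap.finrank_range_of_inj hi, LinearMap.range_domRestrict]

end Openness

section Core

variable {B E F : Type*}
    [CommRing B] [Algebra ℝ B] [CommRing E] [Algebra ℝ E] [CommRing F] [Algebra ℝ F]

theorem ext_tensor (ℬ : ℕ → Submodule ℝ B) (ℱ : ℕ → Submodule ℝ F)
    [GradedAlgebra ℬ] [GradedAlgebra ℱ] (π : B →ₐ[ℝ] E) (σ : F →ₗ[ℝ] E)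
    (Φ : B ⊗[ℝ] F ≃ₗ[ℝ] E) (hΦ : ∀ b φ, Φ (b ⊗ₜ φ) = π b * σ φ)
    {M : Type*} [AddCommGroup M] [Module ℝ M] {g h : E →ₗ[ℝ] M}
    (hgh : ∀ i, ∀ b ∈ ℬ i, ∀ j, ∀ φ ∈ ℱ j, g (π b * σ φ) = h (π b * σ φ)) : g = h := by
  have : g ∘ₗ Φ.toLinearMap = h ∘ₗ Φ.toLinearMap := by
    apply TensorProduct.ext
    apply graded_ext ℬ
    intro i b hb
    apply graded_ext ℱ
    intro j φ hφ
    simpa [hΦ] using hgh i b hb j φ hφ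
  ext y
  have := LinearMap.congr_fun this (Φ.symm y)
  simpa using this

theorem ext_tensor' (π : B →ₐ[ℝ] E) (σ : F →ₗ[ℝ] E)
    (Φ : B ⊗[ℝ] F ≃ₗ[ℝ] E) (hΦ : ∀ b φ, Φ (b ⊗ₜ φ) = π b * σ φ)
    {M : Type*} [AddCommGroup M] [Module ℝ M] {g h : E →ₗ[ℝ] M}
    (hgh : ∀ b φ, g (π b * σ φ) = h (π b * σ φ)) : g = h := by
  have : g ∘ₗ Φ.toLinearMap = h ∘ₗ Φ.toLinearMap := by
    apply TensorProduct.ext'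
    intro b φ
    simpa [hΦ] using hgh b φ
  ext y
  have := LinearMap.congr_fun this (Φ.symm y)
  simpa using this

/-- transport of `TB ⊗ 1 + 1 ⊗ TF` to `E`. -/
noncomputable def dsum (Φ : B ⊗[ℝ] F ≃ₗ[ℝ] E) (TB : Module.End ℝ B) (TF : Module.End ℝ F) :
    Module.End ℝ E :=
  Φ.toLinearMap ∘ₗ (TensorProduct.map TB LinearMap.id + TensorProduct.map LinearMap.id TF) ∘ₗ
    Φ.symm.toLinearMap

theorem dsum_apply (π : B →ₐ[ℝ] E) (σ : F →ₗ[ℝ] E)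
    (Φ : B ⊗[ℝ] F ≃ₗ[ℝ] E) (hΦ : ∀ b φ, Φ (b ⊗ₜ φ) = π b * σ φ)
    (TB : Module.End ℝ B) (TF : Module.End ℝ F) (b : B) (φ : F) :
    dsum Φ TB TF (π b * σ φ) = π (TB b) * σ φ + π b * σ (TF φ) := by
  have hs : Φ.symm (π b * σ φ) = b ⊗ₜ φ := by rw [← hΦ, Φ.symm_apply_apply]
  simp [dsum, hs, hΦ]

theorem dsum_comm (π : B →ₐ[ℝ] E) (σ : F →ₗ[ℝ] E)
    (Φ : B ⊗[ℝ] F ≃ₗ[ℝ] E) (hΦ : ∀ b φ, Φ (b ⊗ₜ φ) = π b * σ φ)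
    (TB SB : Module.End ℝ B) (TF SF : Module.End ℝ F) :
    dsum Φ TB TF * dsum Φ SB SF - dsum Φ SB SF * dsum Φ TB TF
      = dsum Φ (TB * SB - SB * TB) (TF * SF - SF * TF) := by
  apply ext_tensor' π σ Φ hΦ
  intro b φ
  simp only [LinearMap.sub_apply, Module.End.mul_apply, dsum_apply π σ Φ hΦ, map_add, map_sub]
  ring

end Core

section Main

variable {B E F : Type*}
    [CommRing B] [Algebra ℝ B] [CommRing E] [Algebra ℝ E] [CommRing F] [Algebra ℝ F]

theorem core_lefschetz
    (ℬ : ℕ → Submodule ℝ B) (ℰ : ℕ → Submodule ℝ E) (ℱ : ℕ → Submodule ℝ F)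
    [GradedAlgebra ℬ] [GradedAlgebra ℰ] [GradedAlgebra ℱ]
    (b e f : ℕ) [FiniteDimensional ℝ E]
    (hB0 : ℬ 0 = Submodule.span ℝ {1})
    (hrB : ∀ i, b < i → ℬ i = ⊥) (hrE : ∀ i, e < i → ℰ i = ⊥) (hrF : ∀ i, f < i → ℱ i = ⊥)
    (hEtop : ℰ e ≠ ⊥)
    (lam : B) (tau : F) (hlam : lam ∈ ℬ 1) (htau : tau ∈ ℱ 1)
    (VB : Module.End ℝ B) (hVB1 : eul ℬ b * VB = VB * eul ℬ b + (-1 : ℝ) • VB)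
    (hVB2 : LinearMap.mulLeft ℝ lam * VB - VB * LinearMap.mulLeft ℝ lam
      = (2 : ℝ) • eul ℬ b - (b : ℝ) • 1)
    (VF : Module.End ℝ F) (hVF1 : eul ℱ f * VF = VF * eul ℱ f + (-1 : ℝ) • VF)
    (hVF2 : LinearMap.mulLeft ℝ tau * VF - VF * LinearMap.mulLeft ℝ tau
      = (2 : ℝ) • eul ℱ f - (f : ℝ) • 1)
    (π : B →ₐ[ℝ] E) (ι : E →ₐ[ℝ] F)
    (hπ : ∀ i, (ℬ i).map π.toLinearMap ≤ ℰ i)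
    (hιπ : ∀ i, 0 < i → ∀ c ∈ ℬ i, ι (π c) = 0)
    (σ : F →ₗ[ℝ] E) (hσ : ∀ j, ∀ φ ∈ ℱ j, σ φ ∈ ℰ j) (hισ : ∀ φ, ι (σ φ) = φ)
    (Φ : B ⊗[ℝ] F ≃ₗ[ℝ] E) (hΦ : ∀ b φ, Φ (b ⊗ₜ φ) = π b * σ φ)
    (x : E) (hx : x ∈ ℰ 1) (hxτ : ι x = tau) :
    ∃ t : ℝ, IsLefschetzElem ℰ e (π lam + t • x) := by
  have hEu : eul ℰ e = dsum Φ (eul ℬ b) (eul ℱ f) := by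
    apply ext_tensor ℬ ℱ π σ Φ hΦ
    intro i c hc j φ hφ
    have h1 : π c ∈ ℰ i := hπ i ⟨c, hc, rfl⟩
    rw [dsum_apply π σ Φ hΦ, eul_apply ℰ hrE (mul_deg ℰ h1 (hσ j φ hφ)), eul_apply ℬ hrB hc,
      eul_apply ℱ hrF hφ, map_smul, map_smul, smul_mul_assoc, mul_smul_comm]
    push_cast; module
  set Eu := eul ℰ e with hEudef
  let U := dsum Φ (LinearMap.mulLeft ℝ lam) (LinearMap.mulLeft ℝ tau)
  let V := dsum Φ VB VF
  let d : ℝ := (b : ℝ) + f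
  have hU : Eu * U = U * Eu + (1 : ℝ) • U := by
    rw [← sub_eq_iff_eq_add', hEu, dsum_comm π σ Φ hΦ, eul_mul ℬ hrB hlam, eul_mul ℱ hrF htau,
      add_sub_cancel_left, add_sub_cancel_left, one_smul]
  have hV : Eu * V = V * Eu + (-1 : ℝ) • V := by
    rw [← sub_eq_iff_eq_add', hEu, dsum_comm π σ Φ hΦ, hVB1, hVF1,
      add_sub_cancel_left, add_sub_cancel_left]
    apply ext_tensor' π σ Φ hΦ
    intro c φ
    simp only [LinearMap.smul_apply, V, dsum_apply π σ Φ hΦ, map_smul, smul_mul_assoc,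
      mul_smul_comm]
    module
  have hUV : U * V - V * U = (2 : ℝ) • Eu - d • 1 := by
    rw [dsum_comm π σ Φ hΦ, hVB2, hVF2, hEu]
    apply ext_tensor' π σ Φ hΦ
    intro c φ
    simp only [LinearMap.smul_apply, LinearMap.sub_apply, dsum_apply π σ Φ hΦ, map_smul, map_sub,
      smul_mul_assoc, mul_smul_comm, Module.End.one_apply, sub_mul, mul_sub, d]
    module
  have hVnil : ∀ i, ∀ w ∈ ℰ i, (V ^ (i + 1)) w = 0 := by
    intro i w hw
    have h1 := eig_pow hV (eul_apply ℰ hrE hw) (i + 1)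
    apply eig_zero ℰ hrE h1
    intro j _ h
    push_cast at h
    have : (0 : ℝ) ≤ j := j.cast_nonneg
    linarith
  have hUnil : ∀ i, ∀ w ∈ ℰ i, (U ^ (e + 1)) w = 0 := by
    intro i w hw
    have h1 := eig_pow hU (eul_apply ℰ hrE hw) (e + 1)
    apply eig_zero ℰ hrE h1
    intro j hj h
    push_cast at h
    have h2 : (j : ℝ) ≤ e := by exact_mod_cast hj
    have : (0 : ℝ) ≤ i := i.cast_nonneg
    linarith
  have injU : ∀ i N : ℕ, 2 * i + N = b + f → ∀ w ∈ ℰ i, (U ^ N) w = 0 → w = 0 := by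
    intro i N hN w hw h
    refine sl2_inj hU hV hUV (i + 1) (eul_apply ℰ hrE hw) (hVnil i w hw) N ?_ h
    have : (2 : ℝ) * i + N = b + f := by exact_mod_cast hN
    simp only [d]; linarith
  have injV : ∀ i N : ℕ, 2 * i = b + f + N → ∀ w ∈ ℰ i, (V ^ N) w = 0 → w = 0 := by
    intro i N hN w hw h
    refine sl2_inj (Eu := d • 1 - Eu) (U := V) (V := U) (d := d) (a := d - i) ?_ ?_ ?_ (e + 1) ?_
      (hUnil i w hw) N ?_ h
    · rw [sub_mul, hV, mul_sub, smul_mul_assoc, mul_smul_comm, one_mul, mul_one]; module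
    · rw [sub_mul, hU, mul_sub, smul_mul_assoc, mul_smul_comm, one_mul, mul_one]; module
    · rw [← neg_sub, hUV]; module
    · simp only [LinearMap.sub_apply, LinearMap.smul_apply, Module.End.one_apply]
      rw [eul_apply ℰ hrE hw]; module
    · have : (2 : ℝ) * i = b + f + N := by exact_mod_cast hN
      linarith
  have hUdeg : ∀ i N : ℕ, ∀ w ∈ ℰ i, (U ^ N) w ∈ ℰ (i + N) := by
    intro i N w hw
    apply mem_of_eig ℰ hrE
    rw [← hEudef, eig_pow hU (eul_apply ℰ hrE hw)]; push_cast; simp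
  have hVdeg : ∀ i N : ℕ, ∀ w ∈ ℰ (i + N), (V ^ N) w ∈ ℰ i := by
    intro i N w hw
    apply mem_of_eig ℰ hrE
    rw [← hEudef, eig_pow hV (eul_apply ℰ hrE hw)]; push_cast; simp
  have hed : e = b + f := by
    apply le_antisymm
    · by_contra hlt
      push Not at hlt
      apply hEtop
      rw [eq_bot_iff]
      intro w hw
      rw [Submodule.mem_bot]
      apply injV e (2 * e - (b + f)) (by omega) w hw
      have h1 := eig_pow hV (eul_apply ℰ hrE hw) (2 * e - (b + f))
      apply eig_zero ℰ hrE h1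
      intro j _ h
      rw [Nat.cast_sub (by omega)] at h
      push_cast at h
      have h2 : (0 : ℝ) ≤ j := j.cast_nonneg
      have h3 : (b : ℝ) + f < e := by exact_mod_cast hlt
      linarith
    · by_contra hlt
      push Not at hlt
      have h1 : (1 : E) = 0 := by
        apply injU 0 (b + f) (by omega) 1 SetLike.GradedOne.one_mem
        have := hUdeg 0 (b + f) 1 SetLike.GradedOne.one_mem
        rwa [zero_add, hrE _ hlt, Submodule.mem_bot] at this
      apply hEtop
      rw [eq_bot_iff]
      intro w _
      rw [Submodule.mem_bot, ← one_mul w, h1, zero_mul]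
  have hfin : ∀ i, i ≤ e / 2 → Module.finrank ℝ (ℰ (e - i)) ≤ Module.finrank ℝ (ℰ i) := by
    intro i hi
    rw [← finrank_map_of_inj (V ^ (e - 2 * i)) (ℰ (e - i)) (injV _ _ (by omega))]
    apply Submodule.finrank_mono
    rintro _ ⟨w, hw, rfl⟩
    apply hVdeg
    rwa [show i + (e - 2 * i) = e - i by omega]
  -- degeneration
  let Pj : ℕ → Module.End ℝ E := fun j =>
    Φ.toLinearMap ∘ₗ (TensorProduct.map (GradedAlgebra.proj ℬ j) LinearMap.id) ∘ₗ
      Φ.symm.toLinearMap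
  have hsymm : ∀ c φ, Φ.symm (π c * σ φ) = c ⊗ₜ φ := fun c φ => by
    rw [← hΦ, Φ.symm_apply_apply]
  have hPj : ∀ j c φ, Pj j (π c * σ φ) = π (GradedAlgebra.proj ℬ j c) * σ φ := by
    intro j c φ
    simp only [Pj, LinearMap.comp_apply, LinearEquiv.coe_coe, hsymm, TensorProduct.map_tmul, hΦ,
      LinearMap.id_apply]
  let S : ℝ → Module.End ℝ E := fun t => ∑ j ∈ Finset.range (b + 1), t ^ j • Pj j
  have hS : ∀ t i, ∀ c ∈ ℬ i, ∀ φ, S t (π c * σ φ) = t ^ i • (π c * σ φ) := by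
    intro t i c hc φ
    have h1 := gop_apply ℬ hrB (fun j => t ^ j) hc
    simp only [gop, LinearMap.sum_apply, LinearMap.smul_apply] at h1
    simp only [S, LinearMap.sum_apply, LinearMap.smul_apply, hPj]
    rw [← smul_mul_assoc, ← map_smul, ← h1, map_sum, Finset.sum_mul]
    simp only [map_smul, smul_mul_assoc]
  have hSmul : ∀ t i, ∀ c ∈ ℬ i, ∀ y, S t (π c * y) = t ^ i • (π c * S t y) := by
    intro t i c hc y
    have : S t * LinearMap.mulLeft ℝ (π c) = t ^ i • (LinearMap.mulLeft ℝ (π c) * S t) := by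
      apply ext_tensor ℬ ℱ π σ Φ hΦ
      intro k c' hc' j φ hφ
      simp only [Module.End.mul_apply, LinearMap.smul_apply, LinearMap.mulLeft_apply]
      rw [← mul_assoc, ← map_mul, hS t _ _ (mul_deg ℬ hc hc'), hS t _ _ hc', map_mul, pow_add,
        mul_smul_comm, smul_smul, mul_assoc]
    exact LinearMap.congr_fun this y
  have hS0 : ∀ y, S 0 y = σ (ι y) := by
    intro y
    have : S 0 = σ ∘ₗ ι.toLinearMap := by
      apply ext_tensor ℬ ℱ π σ Φ hΦ
      intro i c hc j φ hφ
      rw [hS 0 i c hc]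
      simp only [LinearMap.comp_apply, AlgHom.toLinearMap_apply, map_mul, hισ]
      cases i with
      | zero =>
        obtain ⟨a, rfl⟩ := Submodule.mem_span_singleton.1 (hB0.le hc)
        simp
      | succ i =>
        rw [hιπ _ (Nat.succ_pos i) c hc]; simp
    rw [this]; rfl
  let A0 : Module.End ℝ E := dsum Φ (LinearMap.mulLeft ℝ lam) 0
  let Aj : ℕ → Module.End ℝ E := fun j =>
    thetaMap π (Pj j ∘ₗ LinearMap.mulLeft ℝ x ∘ₗ σ) ∘ₗ Φ.symm.toLinearMap
  let A : ℝ → Module.End ℝ E := fun t => A0 + ∑ j ∈ Finset.range (b + 1), t ^ j • Aj j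
  have hA : ∀ t c φ, A t (π c * σ φ) = π (lam * c) * σ φ + π c * S t (x * σ φ) := by
    intro t c φ
    simp only [A, A0, Aj, S, LinearMap.add_apply, LinearMap.sum_apply, LinearMap.smul_apply,
      dsum_apply π σ Φ hΦ, LinearMap.comp_apply, LinearEquiv.coe_coe, hsymm, thetaMap_tmul,
      LinearMap.mulLeft_apply, LinearMap.zero_apply, map_zero, mul_zero, add_zero, Finset.mul_sum,
      mul_smul_comm]
  have hA0U : A 0 = U := by
    apply ext_tensor' π σ Φ hΦ
    intro c φ
    rw [hA, hS0, map_mul ι, hισ, hxτ, dsum_apply π σ Φ hΦ]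
    rfl
  have hSl : ∀ t, S t * LinearMap.mulLeft ℝ (π lam + t • x) = t • (A t * S t) := by
    intro t
    apply ext_tensor ℬ ℱ π σ Φ hΦ
    intro i c hc j φ hφ
    simp only [Module.End.mul_apply, LinearMap.smul_apply, LinearMap.mulLeft_apply]
    rw [hS t i c hc, map_smul, hA, add_mul, map_add, ← mul_assoc, ← map_mul,
      hS t _ _ (mul_deg ℬ hlam hc), smul_mul_assoc, map_smul, mul_left_comm, hSmul t i c hc,
      pow_add]
    module
  have hSlN : ∀ t N, S t * LinearMap.mulLeft ℝ ((π lam + t • x) ^ N) = t ^ N • (A t ^ N * S t) := by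
    intro t N
    induction N with
    | zero => ext w; simp
    | succ N ih =>
      rw [← LinearMap.pow_mulLeft, pow_succ, LinearMap.pow_mulLeft, ← mul_assoc, ih,
        smul_mul_assoc, mul_assoc, hSl, mul_smul_comm, smul_smul, ← mul_assoc, ← pow_succ,
        ← pow_succ]
  have hSinv : ∀ t, t ≠ 0 → S t⁻¹ * S t = 1 := by
    intro t ht
    apply ext_tensor ℬ ℱ π σ Φ hΦ
    intro i c hc j φ hφ
    rw [Module.End.mul_apply, hS t i c hc, map_smul, hS _ i c hc, smul_smul, ← mul_pow,
      mul_inv_cancel₀ ht, one_pow, one_smul, Module.End.one_apply]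
  have hSdeg : ∀ t i, ∀ w ∈ ℰ i, S t w ∈ ℰ i := by
    intro t i w hw
    have hc : Eu * S t = S t * Eu := by
      apply ext_tensor ℬ ℱ π σ Φ hΦ
      intro i c hc j φ hφ
      have h1 : π c * σ φ ∈ ℰ (i + j) := mul_deg ℰ (hπ i ⟨c, hc, rfl⟩) (hσ j φ hφ)
      rw [Module.End.mul_apply, Module.End.mul_apply, hS t i c hc, map_smul, hEudef,
        eul_apply ℰ hrE h1, map_smul, hS t i c hc, smul_comm]
    apply mem_of_eig ℰ hrE
    have := LinearMap.congr_fun hc w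
    rw [Module.End.mul_apply, Module.End.mul_apply, hEudef, eul_apply ℰ hrE hw, map_smul] at this
    exact this
  have hev : ∀ᶠ t in nhds (0 : ℝ), ∀ i ∈ Finset.range (e / 2 + 1), ∀ w ∈ ℰ i,
      ((A t) ^ (e - 2 * i)) w = 0 → w = 0 := by
    rw [Filter.eventually_all_finset]
    intro i hi
    rw [Finset.mem_range] at hi
    apply eventually_inj (b + 1) A0 Aj A (fun t => rfl)
    rw [hA0U]
    exact injU i _ (by omega)
  obtain ⟨t, ht, ht0⟩ := ((hev.filter_mono nhdsWithin_le_nhds).and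
    (self_mem_nhdsWithin (a := (0 : ℝ)) (s := {0}ᶜ))).exists
  have ht0 : t ≠ 0 := ht0
  have hl : π lam + t • x ∈ ℰ 1 :=
    Submodule.add_mem _ (hπ 1 ⟨lam, hlam, rfl⟩) (Submodule.smul_mem _ _ hx)
  refine ⟨t, hl, ?_⟩
  intro i hi
  have hinj : ∀ w ∈ ℰ i, (π lam + t • x) ^ (e - 2 * i) * w = 0 → w = 0 := by
    intro w hw h
    have h1 := LinearMap.congr_fun (hSlN t (e - 2 * i)) w
    simp only [Module.End.mul_apply, LinearMap.smul_apply, LinearMap.mulLeft_apply, h,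
      map_zero] at h1
    have h2 := (smul_eq_zero.1 h1.symm).resolve_left (pow_ne_zero _ ht0)
    have h3 := ht i (Finset.mem_range.2 (by omega)) _ (hSdeg t i w hw) h2
    have h4 := LinearMap.congr_fun (hSinv t ht0) w
    rw [Module.End.mul_apply, h3, map_zero] at h4
    exact h4.symm
  refine ⟨hinj, ?_⟩
  apply Submodule.eq_of_le_of_finrank_le
  · rintro _ ⟨w, hw, rfl⟩
    rw [show e - i = i + (e - 2 * i) by omega]
    exact pow_mul_deg ℰ hl _ hw
  · rw [finrank_map_of_inj _ _ hinj]
    exact hfin i hi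

end Main

/-- Theorem on deformed tensor products / fiber bundles:
Let (B,λ) and (F,τ) be Lefschetz algebras and E an ℕ-graded Artinian ℝ-algebra with
graded algebra homomorphisms π : B → E and ι : E → F such that E is a free B-module
via π, and ι is surjective with kernel B⁺·E.  Then for any x ∈ E^1 with ι(x) = τ,
there is t ∈ ℝ such that (E, π(λ) + t·x) is a Lefschetz algebra. -/
theorem lefschetz_of_free_fibration {B E F : Type*}
    [CommRing B] [Algebra ℝ B] [CommRing E] [Algebra ℝ E] [CommRing F] [Algebra ℝ F]
    (ℬ : ℕ → Submodule ℝ B) (ℰ : ℕ → Submodule ℝ E) (ℱ : ℕ → Submodule ℝ F)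
    [GradedAlgebra ℬ] [GradedAlgebra ℰ] [GradedAlgebra ℱ]
    (b e f : ℕ)
    (hB : IsGradedArtinian B ℬ b) (hE : IsGradedArtinian E ℰ e)
    (hF : IsGradedArtinian F ℱ f)
    (lam : B) (tau : F) (hlam : IsLefschetzElem ℬ b lam) (htau : IsLefschetzElem ℱ f tau)
    (π : B →ₐ[ℝ] E) (ι : E →ₐ[ℝ] F)
    (hπ : ∀ i, (ℬ i).map π.toLinearMap ≤ ℰ i)
    (hι : ∀ i, (ℰ i).map ι.toLinearMap ≤ ℱ i)
    (hfree : @Module.Free B E _ _ (Module.compHom E π.toRingHom))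
    (hsurj : Function.Surjective ι)
    (hker : RingHom.ker (ι : E →+* F) =
      Ideal.span (⇑π '' (⋃ i : ℕ, ⋃ _ : 0 < i, (ℬ i : Set B))))
    (x : E) (hx : x ∈ ℰ 1) (hxτ : ι x = tau) :
    ∃ t : ℝ, IsLefschetzElem ℰ e (π lam + t • x) := by
  obtain ⟨hBfd, hB0, -, hrB⟩ := id hB
  obtain ⟨hEfd, -, hEtop, hrE⟩ := id hE
  obtain ⟨hFfd, -, -, hrF⟩ := id hF
  obtain ⟨VB, hVB1, hVB2⟩ := exists_lowering ℬ hB hlam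
  obtain ⟨VF, hVF1, hVF2⟩ := exists_lowering ℱ hF htau
  obtain ⟨σ, hσ, hισ⟩ := exists_graded_section ℰ ℱ f hrF ι hι hsurj
  have hbij := thetaMap_bijective ℬ ℰ ℱ hB0 π ι hπ hι hfree hsurj hker σ hσ hισ
  refine core_lefschetz ℬ ℰ ℱ b e f hB0 hrB hrE hrF hEtop lam tau hlam.1 htau.1 VB hVB1 hVB2
    VF hVF1 hVF2 π ι hπ ?_ σ hσ hισ (LinearEquiv.ofBijective _ hbij)
    (fun c φ => thetaMap_tmul π σ c φ) x hx hxτ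
  intro i hi c hc
  have : π c ∈ RingHom.ker (ι : E →+* F) := by
    rw [hker]
    apply Ideal.subset_span
    refine ⟨c, ?_, rfl⟩
    simp only [Set.mem_iUnion]
    exact ⟨i, hi, hc⟩
  exact this
end

section
/- For every χ ∈ S^1 and w ∈ W, the commutator of the operator w^{-1}∘A_w with multiplication by χ equals the sum over all pairs (w', α) with w' → w a Bruhat covering via the positive root α (s_α w' = w, ℓ(w) = ℓ(w')+1) of α̌(w'(χ)) · (w^{-1} ∘ A_{w'}). -/
open scoped RealInnerProductSpace

attribute [local instance] Classical.propDecidable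

/-- The reflection in the vector `γ`: `x ↦ x − (2⟨x,γ⟩/⟨γ,γ⟩)γ`. -/
noncomputable def reflectRoot {n : ℕ} (γ x : EuclideanSpace ℝ (Fin n)) :
    EuclideanSpace ℝ (Fin n) :=
  x - (2 * ⟪x, γ⟫ / ⟪γ, γ⟫) • γ

/-- The coroot functional `γ̌(x) = 2⟨x,γ⟩/⟨γ,γ⟩`. -/
noncomputable def corootPair {n : ℕ} (γ x : EuclideanSpace ℝ (Fin n)) : ℝ :=
  2 * ⟪x, γ⟫ / ⟪γ, γ⟫

/-- A (reduced) root system in Euclidean space `ℝ^n` together with a choice of simple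
system `Δ` and the corresponding positive system `pos`. -/
structure RootData (n : ℕ) where
  /-- The set of roots. -/
  Φ : Set (EuclideanSpace ℝ (Fin n))
  /-- The simple system. -/
  Δ : Set (EuclideanSpace ℝ (Fin n))
  /-- The positive system determined by `Δ`. -/
  pos : Set (EuclideanSpace ℝ (Fin n))
  finite : Φ.Finite
  nonzero : ∀ γ ∈ Φ, γ ≠ 0
  reduced : ∀ γ ∈ Φ, ∀ t : ℝ, t • γ ∈ Φ → t = 1 ∨ t = -1
  reflect_mem : ∀ γ ∈ Φ, ∀ β ∈ Φ, reflectRoot γ β ∈ Φ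
  Δ_sub : Δ ⊆ pos
  pos_sub : pos ⊆ Φ
  simple_indep : LinearIndependent ℝ (fun a : Δ => (a : EuclideanSpace ℝ (Fin n)))
  pos_combo : ∀ γ ∈ pos, ∃ c : EuclideanSpace ℝ (Fin n) →₀ ℝ,
    ↑c.support ⊆ Δ ∧ (∀ a, 0 ≤ c a) ∧ γ = c.sum fun a t => t • a
  pos_partition : ∀ γ ∈ Φ, (γ ∈ pos ∧ -γ ∉ pos) ∨ (γ ∉ pos ∧ -γ ∈ pos)

/-- A vector in ℝ^n regarded as a linear form, i.e. a degree-one polynomial. -/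
noncomputable def toPoly {n : ℕ} (v : EuclideanSpace ℝ (Fin n)) :
    MvPolynomial (Fin n) ℝ :=
  ∑ i, MvPolynomial.C (v i) * MvPolynomial.X i

/-- The action of a linear automorphism of ℝ^n on the polynomial ring S = Sym(ℝ^n),
determined by its action on the degree-one part. -/
noncomputable def polyAct {n : ℕ}
    (g : EuclideanSpace ℝ (Fin n) ≃ₗ[ℝ] EuclideanSpace ℝ (Fin n)) :
    MvPolynomial (Fin n) ℝ →ₐ[ℝ] MvPolynomial (Fin n) ℝ :=
  MvPolynomial.aeval fun i => toPoly (g (EuclideanSpace.single i 1))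

/-- The action of the reflection s_γ on the polynomial ring S = Sym(ℝ^n). -/
noncomputable def reflPolyAct {n : ℕ} (γ : EuclideanSpace ℝ (Fin n)) :
    MvPolynomial (Fin n) ℝ →ₐ[ℝ] MvPolynomial (Fin n) ℝ :=
  MvPolynomial.aeval fun i => toPoly (reflectRoot γ (EuclideanSpace.single i 1))

/-- The Demazure operator A_γ : f ↦ (f − s_γ f)/γ (with junk value 0 if γ does not
divide f − s_γ f; for roots γ the quotient always exists and is unique). -/
noncomputable def demazure {n : ℕ} (γ : EuclideanSpace ℝ (Fin n))
    (f : MvPolynomial (Fin n) ℝ) : MvPolynomial (Fin n) ℝ :=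
  if h : ∃ q, f - reflPolyAct γ f = toPoly γ * q then h.choose else 0

/-- The composite A_{γ₁} ∘ ⋯ ∘ A_{γ_r} of Demazure operators along a word. -/
noncomputable def demazureWord {n : ℕ} (L : List (EuclideanSpace ℝ (Fin n))) :
    MvPolynomial (Fin n) ℝ → MvPolynomial (Fin n) ℝ :=
  L.foldr (fun γ F => demazure γ ∘ F) id

/-- The length of `w` with respect to the simple reflections. -/
noncomputable def RootData.len {n : ℕ} (R : RootData n)
    (w : EuclideanSpace ℝ (Fin n) ≃ₗ[ℝ] EuclideanSpace ℝ (Fin n)) : ℕ :=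
  sInf {k | ∃ Ls : List (EuclideanSpace ℝ (Fin n) ≃ₗ[ℝ] EuclideanSpace ℝ (Fin n)),
    Ls.length = k ∧ (∀ σ ∈ Ls, ∃ γ ∈ R.Δ, ∀ x, σ x = reflectRoot γ x) ∧ Ls.prod = w}

/-- The reflection group `W` generated by the reflections in the roots. -/
noncomputable def RootData.W {n : ℕ} (R : RootData n) :
    Subgroup (EuclideanSpace ℝ (Fin n) ≃ₗ[ℝ] EuclideanSpace ℝ (Fin n)) :=
  Subgroup.closure {σ | ∃ γ ∈ R.Φ, ∀ x, σ x = reflectRoot γ x}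

/-- `L` (a list of roots) is a word for the group element `w`: the product of the
corresponding reflections is `w`. -/
def RootData.IsWordFor {n : ℕ} (R : RootData n) (L : List (EuclideanSpace ℝ (Fin n)))
    (w : EuclideanSpace ℝ (Fin n) ≃ₗ[ℝ] EuclideanSpace ℝ (Fin n)) : Prop :=
  ∃ Ls : List (EuclideanSpace ℝ (Fin n) ≃ₗ[ℝ] EuclideanSpace ℝ (Fin n)),
    List.Forall₂ (fun γ σ => ∀ x, σ x = reflectRoot γ x) L Ls ∧ Ls.prod = w

/-- `L` is a reduced word for `w`: a word of simple roots of minimal length. -/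
def RootData.IsReducedWord {n : ℕ} (R : RootData n)
    (L : List (EuclideanSpace ℝ (Fin n)))
    (w : EuclideanSpace ℝ (Fin n) ≃ₗ[ℝ] EuclideanSpace ℝ (Fin n)) : Prop :=
  (∀ γ ∈ L, γ ∈ R.Δ) ∧ L.length = R.len w ∧ R.IsWordFor L w

/-- The BGG operator A_w, defined via a choice of reduced word for `w`
(by the Bernstein–Gelfand–Gelfand theorem it is independent of this choice). -/
noncomputable def RootData.Aop {n : ℕ} (R : RootData n)
    (w : EuclideanSpace ℝ (Fin n) ≃ₗ[ℝ] EuclideanSpace ℝ (Fin n)) :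
    MvPolynomial (Fin n) ℝ → MvPolynomial (Fin n) ℝ :=
  if h : ∃ L, R.IsReducedWord L w then demazureWord h.choose else fun _ => 0

/-- `w' →_α w`: a Bruhat covering, i.e. α ∈ Φ⁺, s_α·w' = w and ℓ(w) = ℓ(w') + 1. -/
def RootData.Covers {n : ℕ} (R : RootData n)
    (w' : EuclideanSpace ℝ (Fin n) ≃ₗ[ℝ] EuclideanSpace ℝ (Fin n))
    (α : EuclideanSpace ℝ (Fin n))
    (w : EuclideanSpace ℝ (Fin n) ≃ₗ[ℝ] EuclideanSpace ℝ (Fin n)) : Prop :=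
  α ∈ R.pos ∧ (∀ x, (w * w'⁻¹) x = reflectRoot α x) ∧ R.len w = R.len w' + 1


namespace BGGAux

variable {n : ℕ}

local notation "E" n => EuclideanSpace ℝ (Fin n)

theorem corootPair_add (γ x y : E n) : corootPair γ (x + y) = corootPair γ x + corootPair γ y := by
  simp only [corootPair, inner_add_left]; ring

theorem corootPair_smul (γ x : E n) (t : ℝ) : corootPair γ (t • x) = t * corootPair γ x := by
  simp only [corootPair, real_inner_smul_left]; ring

theorem reflectRoot_eq (γ x : E n) : reflectRoot γ x = x - corootPair γ x • γ := rfl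

theorem corootPair_self (γ : E n) (h : γ ≠ 0) : corootPair γ γ = 2 := by
  have : ⟪γ, γ⟫ ≠ 0 := by simpa using h
  simp only [corootPair]; field_simp

theorem reflectRoot_invol (γ x : E n) : reflectRoot γ (reflectRoot γ x) = x := by
  by_cases h : γ = 0
  · simp [reflectRoot, h]
  · have h1 : corootPair γ (reflectRoot γ x) = - corootPair γ x := by
      rw [reflectRoot_eq, sub_eq_add_neg, ← neg_smul, corootPair_add, corootPair_smul,
        corootPair_self γ h]
      ring
    rw [reflectRoot_eq, h1, reflectRoot_eq]
    simp

/-- reflection as a linear equivalence -/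
noncomputable def sr (γ : E n) : (E n) ≃ₗ[ℝ] (E n) :=
  LinearEquiv.ofInvolutive
    { toFun := reflectRoot γ
      map_add' := by
        intro x y
        simp only [reflectRoot_eq, corootPair_add, add_smul]; abel
      map_smul' := by
        intro t x
        simp only [reflectRoot_eq, corootPair_smul, smul_sub, mul_smul, RingHom.id_apply] }
    (reflectRoot_invol γ)

theorem sr_apply (γ x : E n) : sr γ x = reflectRoot γ x := rfl

theorem sr_sr (γ x : E n) : sr γ (sr γ x) = x := reflectRoot_invol γ x

theorem sr_mul_self (γ : E n) : sr γ * sr γ = 1 := by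
  ext1 x; exact sr_sr γ x

theorem sr_inv (γ : E n) : (sr γ)⁻¹ = sr γ := inv_eq_of_mul_eq_one_left (sr_mul_self γ)

theorem sr_self (γ : E n) : sr γ γ = -γ := by
  by_cases h : γ = 0
  · simp [h]
  · rw [sr_apply, reflectRoot_eq, corootPair_self γ h, two_smul]; abel

theorem sr_inner (γ x y : E n) : ⟪sr γ x, sr γ y⟫ = ⟪x, y⟫ := by
  by_cases h : γ = 0
  · simp [sr_apply, reflectRoot, h]
  · have : ⟪γ, γ⟫ ≠ 0 := by simpa using h
    simp only [sr_apply, reflectRoot, inner_sub_left, inner_sub_right, real_inner_smul_left,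
      real_inner_smul_right, real_inner_comm γ]
    rw [real_inner_comm x γ]
    field_simp
    ring

theorem corootPair_sr (γ β x : E n) : corootPair (sr γ β) (sr γ x) = corootPair β x := by
  simp only [corootPair, sr_inner]

theorem sr_conj (γ β : E n) : sr (sr γ β) = sr γ * sr β * sr γ := by
  ext1 x
  change sr (sr γ β) x = sr γ (sr β (sr γ x))
  have h := corootPair_sr γ β (sr γ x)
  rw [sr_sr] at h
  rw [sr_apply (sr γ β), reflectRoot_eq, h, sr_apply β, reflectRoot_eq, map_sub, sr_sr, map_smul]

variable (R : RootData n)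

theorem Δ_Φ {γ : E n} (h : γ ∈ R.Δ) : γ ∈ R.Φ := R.pos_sub (R.Δ_sub h)

theorem sr_Φ {γ β : E n} (h : γ ∈ R.Φ) (hb : β ∈ R.Φ) : sr γ β ∈ R.Φ := R.reflect_mem γ h β hb

theorem indep (l : (E n) →₀ ℝ) (hl : ↑l.support ⊆ R.Δ) (h0 : (l.sum fun a t => t • a) = 0) :
    l = 0 := by
  have h : LinearIndepOn ℝ (id : (E n) → (E n)) R.Δ := R.simple_indep
  exact linearIndepOn_iff.1 h l ((Finsupp.mem_supported _ _).2 hl) h0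

/-- a simple reflection permutes the other positive roots -/
theorem sr_pos {γ β : E n} (hγ : γ ∈ R.Δ) (hβ : β ∈ R.pos) (hne : β ≠ γ) : sr γ β ∈ R.pos := by
  by_contra hcon
  have hΦ := sr_Φ R (Δ_Φ R hγ) (R.pos_sub hβ)
  have hneg : -(sr γ β) ∈ R.pos := by
    rcases R.pos_partition _ hΦ with h | h
    · exact absurd h.1 hcon
    · exact h.2
  obtain ⟨c, hc, hc0, hce⟩ := R.pos_combo _ hβ
  obtain ⟨d, hd, hd0, hde⟩ := R.pos_combo _ hneg
  set t := corootPair γ β with ht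
  have hl := indep R (c + d - Finsupp.single γ t) (by
      intro a ha
      by_contra hna
      have h1 : c a = 0 := by
        by_contra h; exact hna (hc (by simpa using h))
      have h2 : d a = 0 := by
        by_contra h; exact hna (hd (by simpa using h))
      have h3 : γ ≠ a := by rintro rfl; exact hna hγ
      simp [h1, h2, Finsupp.single_apply, h3] at ha)
    (by
      rw [Finsupp.sum_sub_index (by intros; rw [sub_smul]), Finsupp.sum_add_index' (by simp)
        (by intros; rw [add_smul]), ← hce, ← hde, Finsupp.sum_single_index (by simp),
        sr_apply, reflectRoot_eq]
      abel)
  have hca : ∀ a, a ≠ γ → c a = 0 := by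
    intro a ha
    have := DFunLike.congr_fun hl a
    simp [Finsupp.single_apply, ha.symm] at this
    linarith [hc0 a, hd0 a]
  have hcs : c = Finsupp.single γ (c γ) := by
    ext a
    by_cases h : a = γ
    · subst h; simp
    · rw [hca a h, Finsupp.single_apply, if_neg (Ne.symm h)]
  have hb : β = c γ • γ := by
    rw [hcs, Finsupp.sum_single_index (by simp)] at hce
    exact hce
  rcases R.reduced γ (Δ_Φ R hγ) (c γ) (hb ▸ R.pos_sub hβ) with h | h
  · rw [h, one_smul] at hb; exact hne hb
  · have := hc0 γ; linarith

/-- product of reflections of a word -/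
noncomputable def wp (L : List (E n)) : (E n) ≃ₗ[ℝ] (E n) := (L.map sr).prod

theorem wp_cons (γ : E n) (L : List (E n)) : wp (γ :: L) = sr γ * wp L := by simp [wp]

theorem isWordFor_iff (L : List (E n)) (w : (E n) ≃ₗ[ℝ] (E n)) : R.IsWordFor L w ↔ wp L = w := by
  constructor
  · rintro ⟨Ls, h, rfl⟩
    rw [wp]
    congr 1
    induction h with
    | nil => rfl
    | cons h _ ih => 
      rw [List.map_cons, ih]
      congr 1
      ext1 x; exact (h x).symm
  · rintro rfl
    refine ⟨L.map sr, ?_, rfl⟩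
    induction L with
    | nil => exact List.Forall₂.nil
    | cons a L ih => exact List.Forall₂.cons (fun x => rfl) ih

theorem simple_list (Ls : List ((E n) ≃ₗ[ℝ] (E n)))
    (h : ∀ σ ∈ Ls, ∃ γ ∈ R.Δ, ∀ x, σ x = reflectRoot γ x) :
    ∃ L : List (E n), (∀ γ ∈ L, γ ∈ R.Δ) ∧ L.map sr = Ls := by
  induction Ls with
  | nil => exact ⟨[], by simp, rfl⟩
  | cons σ Ls ih =>
    obtain ⟨L, h1, h2⟩ := ih (fun τ hτ => h τ (List.mem_cons_of_mem _ hτ))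
    obtain ⟨γ, hγ, hs⟩ := h σ List.mem_cons_self
    refine ⟨γ :: L, ?_, ?_⟩
    · intro δ hδ
      rcases List.mem_cons.1 hδ with rfl | h'
      · exact hγ
      · exact h1 δ h'
    · rw [List.map_cons, h2]
      congr 1
      ext1 x; exact (hs x).symm

theorem len_le {L : List (E n)} (h : ∀ γ ∈ L, γ ∈ R.Δ) : R.len (wp L) ≤ L.length := by
  apply Nat.sInf_le
  refine ⟨L.map sr, by simp, ?_, rfl⟩
  intro σ hσ
  obtain ⟨γ, hγ, rfl⟩ := List.mem_map.1 hσ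
  exact ⟨γ, h γ hγ, fun x => rfl⟩

/-- `w` is a product of simple reflections -/
def Simp (w : (E n) ≃ₗ[ℝ] (E n)) : Prop := ∃ L : List (E n), (∀ γ ∈ L, γ ∈ R.Δ) ∧ wp L = w

theorem exists_red {w : (E n) ≃ₗ[ℝ] (E n)} (h : Simp R w) : ∃ L : List (E n),
    (∀ γ ∈ L, γ ∈ R.Δ) ∧ L.length = R.len w ∧ wp L = w := by
  obtain ⟨L, hL, hw⟩ := h
  have hne : {k | ∃ Ls : List ((E n) ≃ₗ[ℝ] (E n)),
    Ls.length = k ∧ (∀ σ ∈ Ls, ∃ γ ∈ R.Δ, ∀ x, σ x = reflectRoot γ x) ∧ Ls.prod = w}.Nonempty := by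
    refine ⟨_, L.map sr, rfl, ?_, hw⟩
    intro σ hσ
    obtain ⟨γ, hγ, rfl⟩ := List.mem_map.1 hσ
    exact ⟨γ, hL γ hγ, fun x => rfl⟩
  obtain ⟨Ls, h1, h2, h3⟩ := Nat.sInf_mem hne
  obtain ⟨L', h4, h5⟩ := simple_list R Ls h2
  refine ⟨L', h4, ?_, ?_⟩
  · rw [← List.length_map (f := sr), h5]; exact h1
  · rw [wp, h5, h3]

theorem Simp.mul {w v : (E n) ≃ₗ[ℝ] (E n)} (h : Simp R w) (h' : Simp R v) : Simp R (w * v) := by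
  obtain ⟨L, hL, rfl⟩ := h
  obtain ⟨L', hL', rfl⟩ := h'
  refine ⟨L ++ L', ?_, by simp [wp]⟩
  intro γ hγ
  rcases List.mem_append.1 hγ with h | h
  · exact hL _ h
  · exact hL' _ h

theorem simp_sr {γ : E n} (h : γ ∈ R.Δ) : Simp R (sr γ) := ⟨[γ], by simpa using h, by simp [wp]⟩

theorem simp_one : Simp R (1 : (E n) ≃ₗ[ℝ] (E n)) := ⟨[], by simp, by simp [wp]⟩

theorem exists_height : ∃ φ : (E n) →ₗ[ℝ] ℝ, ∀ γ ∈ R.Δ, φ γ = 1 := by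
  have h : LinearIndepOn ℝ (id : (E n) → (E n)) R.Δ := R.simple_indep
  refine ⟨(Module.Basis.extend h).constr ℝ (fun _ => (1 : ℝ)), ?_⟩
  intro γ hγ
  have hm : γ ∈ h.extend (Set.subset_univ _) := h.subset_extend _ hγ
  have := (Module.Basis.extend h).constr_basis ℝ (fun _ => (1 : ℝ)) ⟨γ, hm⟩
  rwa [Module.Basis.extend_apply_self] at this

theorem exists_simple_inner_pos {β : E n} (h : β ∈ R.pos) : ∃ γ ∈ R.Δ, 0 < ⟪β, γ⟫ := by
  by_contra! hcon
  obtain ⟨c, hc, hc0, hce⟩ := R.pos_combo _ h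
  have h1 : 0 < ⟪β, β⟫ := real_inner_self_pos.2 (R.nonzero _ (R.pos_sub h))
  have h2 : ⟪β, β⟫ = c.sum fun a t => t * ⟪β, a⟫ := by
    have h3 : ⟪β, β⟫ = ⟪c.sum fun a t => t • a, β⟫ := by rw [← hce]
    rw [h3, Finsupp.sum, sum_inner]
    refine Finset.sum_congr rfl fun a _ => ?_
    rw [real_inner_smul_left, real_inner_comm]
  have h3 : (c.sum fun a t => t * ⟪β, a⟫) ≤ 0 := by
    apply Finset.sum_nonpos
    intro a ha
    exact mul_nonpos_of_nonneg_of_nonpos (hc0 a) (hcon a (hc ha))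
  linarith

theorem simp_sr_pos {β : E n} (h : β ∈ R.pos) : Simp R (sr β) := by
  obtain ⟨φ, hφ⟩ := exists_height R
  by_contra hns
  let T : Set (E n) := {β | β ∈ R.pos ∧ ¬ Simp R (sr β)}
  have hT : T.Finite := R.finite.subset fun x hx => R.pos_sub hx.1
  obtain ⟨δ, hδ, hmin⟩ := Set.exists_min_image T φ hT ⟨β, h, hns⟩
  obtain ⟨γ, hγ, hin⟩ := exists_simple_inner_pos R hδ.1
  have hne : δ ≠ γ := by
    rintro rfl; exact hδ.2 (simp_sr R hγ)
  have hp := sr_pos R hγ hδ.1 hne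
  have hγγ : 0 < ⟪γ, γ⟫ := real_inner_self_pos.2 (R.nonzero _ (Δ_Φ R hγ))
  have hcp : 0 < corootPair γ δ := by unfold corootPair; positivity
  have hlt : φ (sr γ δ) < φ δ := by
    rw [sr_apply, reflectRoot_eq, map_sub, map_smul, hφ γ hγ, smul_eq_mul]; linarith
  have hs : Simp R (sr (sr γ δ)) := by
    by_contra hn
    exact absurd (hmin _ ⟨hp, hn⟩) (not_le.2 hlt)
  apply hδ.2
  have := sr_conj γ (sr γ δ)
  rw [sr_sr] at this
  rw [this]
  exact ((simp_sr R hγ).mul R hs).mul R (simp_sr R hγ)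

theorem sr_neg (β : E n) : sr (-β) = sr β := by
  ext1 x
  simp [sr_apply, reflectRoot, neg_div, sub_eq_add_neg]

theorem simp_sr_Φ {β : E n} (h : β ∈ R.Φ) : Simp R (sr β) := by
  rcases R.pos_partition _ h with h | h
  · exact simp_sr_pos R h.1
  · rw [← sr_neg]; exact simp_sr_pos R h.2

theorem simp_of_W {w : (E n) ≃ₗ[ℝ] (E n)} (h : w ∈ R.W) : Simp R w := by
  refine Subgroup.closure_induction'' (p := fun w _ => Simp R w) ?_ ?_ (simp_one R)
    (fun x y _ _ hx hy => hx.mul R hy) h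
  · rintro x ⟨γ, hγ, hx⟩
    have : x = sr γ := by ext1 y; exact hx y
    rw [this]; exact simp_sr_Φ R hγ
  · rintro x ⟨γ, hγ, hx⟩
    have : x = sr γ := by ext1 y; exact hx y
    rw [this, sr_inv]; exact simp_sr_Φ R hγ

theorem wp_inv_Φ {L : List (E n)} (hL : ∀ γ ∈ L, γ ∈ R.Δ) {β : E n} (hβ : β ∈ R.Φ) :
    (wp L)⁻¹ β ∈ R.Φ := by
  induction L generalizing β with
  | nil => simpa [wp] using hβ
  | cons γ L ih =>
    rw [wp_cons, mul_inv_rev, sr_inv]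
    exact ih (fun δ hδ => hL δ (List.mem_cons_of_mem _ hδ))
      (sr_Φ R (Δ_Φ R (hL γ List.mem_cons_self)) hβ)

/-- the exchange property -/
theorem exchange {L : List (E n)} (hL : ∀ γ ∈ L, γ ∈ R.Δ) {β : E n} (hβ : β ∈ R.pos)
    (hneg : (wp L)⁻¹ β ∉ R.pos) :
    ∃ L' : List (E n), (∀ γ ∈ L', γ ∈ R.Δ) ∧ L'.length + 1 = L.length ∧ wp L' = sr β * wp L := by
  induction L generalizing β with
  | nil => simp [wp] at hneg; exact absurd hβ hneg
  | cons γ L ih =>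
    have hL1 : ∀ δ ∈ L, δ ∈ R.Δ := fun δ hδ => hL δ (List.mem_cons_of_mem _ hδ)
    have hγ : γ ∈ R.Δ := hL γ List.mem_cons_self
    by_cases h : β = γ
    · subst h
      exact ⟨L, hL1, rfl, by rw [wp_cons, ← mul_assoc, sr_mul_self, one_mul]⟩
    · obtain ⟨L', h1, h2, h3⟩ := ih hL1 (sr_pos R hγ hβ h) (by
        rw [wp_cons, mul_inv_rev, sr_inv] at hneg; exact hneg)
      refine ⟨γ :: L', ?_, by simp [h2], ?_⟩
      · intro δ hδ
        rcases List.mem_cons.1 hδ with rfl | h'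
        · exact hγ
        · exact h1 δ h'
      · rw [wp_cons, wp_cons, h3, sr_conj]
        simp only [← mul_assoc, sr_mul_self, one_mul]

theorem len_lt_of_neg {w : (E n) ≃ₗ[ℝ] (E n)} (hw : Simp R w) {β : E n} (hβ : β ∈ R.pos)
    (hneg : w⁻¹ β ∉ R.pos) : R.len (sr β * w) < R.len w := by
  obtain ⟨L, h1, h2, rfl⟩ := exists_red R hw
  obtain ⟨L', h3, h4, h5⟩ := exchange R h1 hβ hneg
  have := len_le R h3
  rw [h5] at this
  omega

theorem len_lt_of_pos {w : (E n) ≃ₗ[ℝ] (E n)} (hw : Simp R w) {β : E n} (hβ : β ∈ R.pos)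
    (hp : w⁻¹ β ∈ R.pos) : R.len w < R.len (sr β * w) := by
  have h := len_lt_of_neg R (w := sr β * w) ((simp_sr_pos R hβ).mul R hw) hβ (by
    rw [mul_inv_rev, sr_inv]
    change w⁻¹ (sr β β) ∉ R.pos
    rw [sr_self, map_neg]
    rcases R.pos_partition _ (R.pos_sub hp) with h | h
    · exact h.2
    · exact absurd hp h.1)
  rwa [← mul_assoc, sr_mul_self, one_mul] at h

theorem len_sr_le {w : (E n) ≃ₗ[ℝ] (E n)} (hw : Simp R w) {γ : E n} (hγ : γ ∈ R.Δ) :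
    R.len (sr γ * w) ≤ R.len w + 1 := by
  obtain ⟨L, h1, h2, rfl⟩ := exists_red R hw
  have := len_le R (L := γ :: L) (by simpa using ⟨hγ, h1⟩)
  rw [wp_cons] at this
  simpa [← h2] using this

theorem len_le_sr {w : (E n) ≃ₗ[ℝ] (E n)} (hw : Simp R w) {γ : E n} (hγ : γ ∈ R.Δ) :
    R.len w ≤ R.len (sr γ * w) + 1 := by
  have := len_sr_le R ((simp_sr R hγ).mul R hw) hγ
  rwa [← mul_assoc, sr_mul_self, one_mul] at this

/-- the key combinatorial fact about coverings -/
theorem cover_iff {v : (E n) ≃ₗ[ℝ] (E n)} (hv : Simp R v) {γ β : E n} (hγ : γ ∈ R.Δ)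
    (hl : R.len (sr γ * v) = R.len v + 1) (hβ : β ∈ R.pos) (hne : β ≠ γ) :
    R.len (sr γ * v) = R.len (sr (sr γ β) * (sr γ * v)) + 1 ↔
      R.len v = R.len (sr β * v) + 1 ∧
        R.len (sr γ * (sr β * v)) = R.len (sr β * v) + 1 := by
  have e : sr (sr γ β) * (sr γ * v) = sr γ * (sr β * v) := by
    rw [sr_conj]; simp only [mul_assoc]; rw [← mul_assoc (sr γ) (sr γ), sr_mul_self, one_mul]
  have hsb : Simp R (sr β * v) := (simp_sr_pos R hβ).mul R hv
  rw [e]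
  constructor
  · intro h
    have hα := sr_pos R hγ hβ hne
    have hlt : R.len (sr β * v) < R.len v := by
      apply len_lt_of_neg R hv hβ
      intro hp
      have := len_lt_of_pos R (w := sr γ * v) ((simp_sr R hγ).mul R hv) hα (by
        rw [mul_inv_rev, sr_inv]
        change v⁻¹ (sr γ (sr γ β)) ∈ R.pos
        rwa [sr_sr])
      rw [e] at this
      omega
    have := len_sr_le R hsb hγ
    omega
  · rintro ⟨h1, h2⟩
    omega

theorem len_dichotomy {w : (E n) ≃ₗ[ℝ] (E n)} (hw : Simp R w) {γ : E n} (hγ : γ ∈ R.Δ) :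
    R.len (sr γ * w) = R.len w + 1 ∨ R.len w = R.len (sr γ * w) + 1 := by
  have h1 := len_sr_le R hw hγ
  have h2 := len_le_sr R hw hγ
  by_cases h : w⁻¹ γ ∈ R.pos
  · have := len_lt_of_pos R hw (R.Δ_sub hγ) h; omega
  · have := len_lt_of_neg R hw (R.Δ_sub hγ) h; omega

theorem toPoly_add (x y : E n) : toPoly (x + y) = toPoly x + toPoly y := by
  simp [toPoly, add_mul, Finset.sum_add_distrib]

theorem toPoly_smul (t : ℝ) (x : E n) : toPoly (t • x) = t • toPoly x := by
  simp only [toPoly, Finset.smul_sum, MvPolynomial.smul_eq_C_mul]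
  simp [mul_assoc]

/-- `toPoly` as a linear map -/
noncomputable def toPolyL : (E n) →ₗ[ℝ] MvPolynomial (Fin n) ℝ where
  toFun := toPoly
  map_add' := toPoly_add
  map_smul' := toPoly_smul

theorem toPoly_single (i : Fin n) : toPoly (EuclideanSpace.single i (1 : ℝ)) = MvPolynomial.X i := by
  rw [toPoly, Finset.sum_eq_single i]
  · simp
  · intro j _ hj; simp [hj]
  · simp

theorem toPoly_ne_zero {γ : E n} (h : γ ≠ 0) : toPoly γ ≠ 0 := by
  intro h0
  apply h
  ext i
  have := congrArg (MvPolynomial.eval (Pi.single i (1 : ℝ))) h0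
  simpa [toPoly, Pi.single_apply] using this

theorem vec_eq_sum (v : E n) : v = ∑ i, v i • EuclideanSpace.single i (1 : ℝ) := by
  ext j
  simp [Pi.single_apply]

theorem polyAct_toPoly (g : (E n) ≃ₗ[ℝ] (E n)) (v : E n) :
    polyAct g (toPoly v) = toPoly (g v) := by
  have h : toPoly (g v) = toPolyL (g v) := rfl
  rw [h]
  conv_rhs => rw [vec_eq_sum v]
  rw [map_sum, map_sum, toPoly, map_sum]
  refine Finset.sum_congr rfl fun i _ => ?_
  rw [map_smul, map_smul, ← MvPolynomial.smul_eq_C_mul, map_smul]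
  congr 1
  exact MvPolynomial.aeval_X _ i

theorem reflPolyAct_eq (γ : E n) : reflPolyAct γ = polyAct (sr γ) := rfl

theorem demazure_exists (γ : E n) (f : MvPolynomial (Fin n) ℝ) :
    ∃ q, f - reflPolyAct γ f = toPoly γ * q := by
  induction f using MvPolynomial.induction_on with
  | C a => exact ⟨0, by simp [MvPolynomial.algHom_C]⟩
  | add p q hp hq =>
    obtain ⟨a, ha⟩ := hp
    obtain ⟨b, hb⟩ := hq
    exact ⟨a + b, by rw [map_add, mul_add, ← ha, ← hb]; ring⟩
  | mul_X p i hp =>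
    obtain ⟨a, ha⟩ := hp
    have h : reflPolyAct γ (MvPolynomial.X i) = MvPolynomial.X i -
        corootPair γ (EuclideanSpace.single i (1 : ℝ)) • toPoly γ := by
      rw [← toPoly_single, reflPolyAct_eq, polyAct_toPoly, sr_apply, reflectRoot_eq,
        sub_eq_add_neg, ← neg_smul, toPoly_add, toPoly_smul, neg_smul, sub_eq_add_neg]
    refine ⟨a * MvPolynomial.X i + reflPolyAct γ p *
      MvPolynomial.C (corootPair γ (EuclideanSpace.single i (1 : ℝ))), ?_⟩
    rw [map_mul, h, MvPolynomial.smul_eq_C_mul]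
    linear_combination MvPolynomial.X i * ha

theorem demazure_spec (γ : E n) (f : MvPolynomial (Fin n) ℝ) :
    f - reflPolyAct γ f = toPoly γ * demazure γ f := by
  have h := demazure_exists γ f
  rw [demazure, dif_pos h]
  exact h.choose_spec

theorem demazure_unique {γ : E n} (h : γ ≠ 0) {f q : MvPolynomial (Fin n) ℝ}
    (hq : f - reflPolyAct γ f = toPoly γ * q) : demazure γ f = q :=
  mul_left_cancel₀ (toPoly_ne_zero h) ((demazure_spec γ f).symm.trans hq)

theorem demazure_add {γ : E n} (h : γ ≠ 0) (f g : MvPolynomial (Fin n) ℝ) :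
    demazure γ (f + g) = demazure γ f + demazure γ g := by
  apply demazure_unique h
  rw [mul_add, ← demazure_spec, ← demazure_spec, map_add]; ring

theorem demazure_smul {γ : E n} (h : γ ≠ 0) (t : ℝ) (f : MvPolynomial (Fin n) ℝ) :
    demazure γ (t • f) = t • demazure γ f := by
  apply demazure_unique h
  rw [mul_smul_comm, ← demazure_spec, map_smul, smul_sub]

theorem demazure_C {γ : E n} (h : γ ≠ 0) (t : ℝ) :
    demazure γ (MvPolynomial.C t) = 0 := by
  apply demazure_unique h
  simp [MvPolynomial.algHom_C]

theorem demazure_zero {γ : E n} (h : γ ≠ 0) : demazure γ 0 = 0 := by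
  apply demazure_unique h
  simp

theorem demazure_sum {γ : E n} (h : γ ≠ 0) {ι : Type*} (s : Finset ι)
    (f : ι → MvPolynomial (Fin n) ℝ) :
    demazure γ (∑ i ∈ s, f i) = ∑ i ∈ s, demazure γ (f i) := by
  induction s using Finset.induction_on with
  | empty => simp [demazure_zero h]
  | insert a s ha ih => rw [Finset.sum_insert ha, Finset.sum_insert ha, demazure_add h, ih]

theorem demazure_toPoly_mul {γ : E n} (h : γ ≠ 0) (c : E n) (f : MvPolynomial (Fin n) ℝ) :
    demazure γ (toPoly c * f) = toPoly (sr γ c) * demazure γ f + corootPair γ c • f := by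
  apply demazure_unique h
  have h1 : toPoly c = toPoly (sr γ c) + corootPair γ c • toPoly γ := by
    rw [← toPoly_smul, ← toPoly_add, sr_apply, reflectRoot_eq, sub_add_cancel]
  rw [map_mul, reflPolyAct_eq, polyAct_toPoly, ← reflPolyAct_eq, mul_add]
  have h2 := demazure_spec γ f
  rw [mul_smul_comm, ← smul_mul_assoc]
  linear_combination toPoly (sr γ c) * h2 + f * h1

theorem demazure_demazure {γ : E n} (h : γ ≠ 0) (f : MvPolynomial (Fin n) ℝ) :
    demazure γ (demazure γ f) = 0 := by
  apply demazure_unique h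
  have h1 := demazure_spec γ f
  have h2 := congrArg (reflPolyAct γ) h1
  have h3 : reflPolyAct γ (reflPolyAct γ f) = f := by
    have : (reflPolyAct γ).comp (reflPolyAct γ) = AlgHom.id ℝ _ := by
      apply MvPolynomial.algHom_ext
      intro i
      rw [AlgHom.comp_apply, ← toPoly_single, reflPolyAct_eq, polyAct_toPoly, polyAct_toPoly, sr_sr]
      rfl
    exact DFunLike.congr_fun this f
  have h4 : reflPolyAct γ (toPoly γ) = - toPoly γ := by
    rw [reflPolyAct_eq, polyAct_toPoly, sr_self, ← neg_one_smul ℝ γ, toPoly_smul, neg_one_smul]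
  rw [map_sub, map_mul, h3, h4] at h2
  apply mul_left_cancel₀ (toPoly_ne_zero h)
  linear_combination -h1 - h2

theorem dw_cons (γ : E n) (L : List (E n)) (f : MvPolynomial (Fin n) ℝ) :
    demazureWord (γ :: L) f = demazure γ (demazureWord L f) := rfl

theorem dw_add {L : List (E n)} (h : ∀ γ ∈ L, γ ≠ 0) (f g : MvPolynomial (Fin n) ℝ) :
    demazureWord L (f + g) = demazureWord L f + demazureWord L g := by
  induction L with
  | nil => rfl
  | cons γ L ih =>
    rw [dw_cons, ih (fun δ hδ => h δ (List.mem_cons_of_mem _ hδ)),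
      demazure_add (h γ List.mem_cons_self)]
    rfl

theorem dw_C {L : List (E n)} (h : ∀ γ ∈ L, γ ≠ 0) (t : ℝ) (hne : L ≠ []) :
    demazureWord L (MvPolynomial.C t) = 0 := by
  induction L with
  | nil => exact absurd rfl hne
  | cons γ L ih =>
    have hγ := h γ List.mem_cons_self
    rw [dw_cons]
    by_cases hL : L = []
    · subst hL; exact demazure_C hγ t
    · rw [ih (fun δ hδ => h δ (List.mem_cons_of_mem _ hδ)) hL, demazure_zero hγ]

/-- the positive roots as a finset -/
noncomputable def posF : Finset (E n) := (R.finite.subset R.pos_sub).toFinset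

theorem mem_posF {α : E n} : α ∈ posF R ↔ α ∈ R.pos := by simp [posF]

/-- the summand attached to a positive root -/
noncomputable def covTerm (w : (E n) ≃ₗ[ℝ] (E n)) (c : E n) (f : MvPolynomial (Fin n) ℝ) (α : E n) :
    MvPolynomial (Fin n) ℝ :=
  if R.len w = R.len (sr α * w) + 1 then
    corootPair α ((sr α * w) c) • R.Aop (sr α * w) f else 0

/-- reducedness in convenient form -/
def Red (L : List (E n)) : Prop := (∀ γ ∈ L, γ ∈ R.Δ) ∧ L.length = R.len (wp L)

theorem Red.ne {L : List (E n)} (h : Red R L) : ∀ γ ∈ L, γ ≠ 0 :=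
  fun γ hγ => R.nonzero _ (Δ_Φ R (h.1 γ hγ))

theorem Red.simp {L : List (E n)} (h : Red R L) : Simp R (wp L) := ⟨L, h.1, rfl⟩

theorem Red.cons {γ : E n} {L : List (E n)} (h : Red R L) (hγ : γ ∈ R.Δ)
    (hl : R.len (sr γ * wp L) = R.len (wp L) + 1) : Red R (γ :: L) := by
  refine ⟨by simpa using ⟨hγ, h.1⟩, ?_⟩
  rw [wp_cons, hl, List.length_cons, h.2]

theorem Red.tail {γ : E n} {L : List (E n)} (h : Red R (γ :: L)) :
    Red R L ∧ γ ∈ R.Δ ∧ R.len (sr γ * wp L) = R.len (wp L) + 1 := by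
  have h1 : ∀ δ ∈ L, δ ∈ R.Δ := fun δ hδ => h.1 δ (List.mem_cons_of_mem _ hδ)
  have hγ := h.1 γ List.mem_cons_self
  have h2 := h.2
  rw [wp_cons, List.length_cons] at h2
  have h3 := len_le R h1
  have h4 := len_sr_le R (w := wp L) ⟨L, h1, rfl⟩ hγ
  exact ⟨⟨h1, by omega⟩, hγ, by omega⟩

theorem exists_Red {w : (E n) ≃ₗ[ℝ] (E n)} (h : Simp R w) : ∃ L, Red R L ∧ wp L = w := by
  obtain ⟨L, h1, h2, rfl⟩ := exists_red R h
  exact ⟨L, ⟨h1, h2⟩, rfl⟩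

theorem Aop_eq_some {w : (E n) ≃ₗ[ℝ] (E n)} (h : Simp R w) :
    ∃ L, Red R L ∧ wp L = w ∧ R.Aop w = demazureWord L := by
  obtain ⟨L, hL, hw⟩ := exists_Red R h
  have hex : ∃ L, R.IsReducedWord L w :=
    ⟨L, hL.1, hw ▸ hL.2, (isWordFor_iff R L w).2 hw⟩
  have hs := hex.choose_spec
  have hw' := (isWordFor_iff R _ w).1 hs.2.2
  refine ⟨hex.choose, ⟨hs.1, ?_⟩, hw', by rw [RootData.Aop, dif_pos hex]⟩
  rw [hw']; exact hs.2.1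

theorem dw_main (r : ℕ) :
    (∀ L, Red R L → L.length ≤ r → ∀ c f, demazureWord L (toPoly c * f) =
      toPoly (wp L c) * demazureWord L f + ∑ α ∈ posF R, covTerm R (wp L) c f α) ∧
    (∀ L, Red R L → L.length ≤ r → R.Aop (wp L) = demazureWord L) := by
  induction r with
  | zero =>
    constructor
    · intro L hL h c f
      obtain rfl : L = [] := List.length_eq_zero_iff.1 (by omega)
      rw [Finset.sum_eq_zero]
      · simp [demazureWord, wp]
      · intro α _
        have := hL.2
        rw [covTerm, if_neg (by simp at this; omega)]
    · intro L hL h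
      obtain rfl : L = [] := List.length_eq_zero_iff.1 (by omega)
      obtain ⟨L', h1, h2, h3⟩ := Aop_eq_some R hL.simp
      have := h1.2
      rw [h2, ← hL.2] at this
      obtain rfl : L' = [] := List.length_eq_zero_iff.1 this
      exact h3
  | succ r ih =>
    obtain ⟨iha, ihb⟩ := ih
    have ha : ∀ L, Red R L → L.length ≤ r + 1 → ∀ c f, demazureWord L (toPoly c * f) =
      toPoly (wp L c) * demazureWord L f + ∑ α ∈ posF R, covTerm R (wp L) c f α := by
      intro L hL hlen c f
      cases L with
      | nil => exact iha [] hL (by simp) c f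
      | cons γ L =>
        obtain ⟨hL', hγ, hl⟩ := hL.tail
        have hlen' : L.length ≤ r := by simpa using hlen
        have hγ0 := R.nonzero _ (Δ_Φ R hγ)
        have hs := hL'.simp
        have hγp : γ ∈ posF R := (mem_posF R).2 (R.Δ_sub hγ)
        rw [dw_cons, iha L hL' hlen', demazure_add hγ0, demazure_toPoly_mul hγ0, wp_cons, dw_cons,
          demazure_sum hγ0, add_assoc]
        congr 1
        rw [← Finset.add_sum_erase _ _ hγp, ← Finset.add_sum_erase _ (covTerm R (sr γ * wp L) c f) hγp]
        have e : sr γ * (sr γ * wp L) = wp L := by rw [← mul_assoc, sr_mul_self, one_mul]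
        have t1 : covTerm R (wp L) c f γ = 0 := by
          rw [covTerm, if_neg (by omega)]
        have t2 : covTerm R (sr γ * wp L) c f γ = corootPair γ (wp L c) • demazureWord L f := by
          rw [covTerm, e, if_pos hl, ihb L hL' hlen']
        rw [t1, t2, demazure_zero hγ0, zero_add]
        congr 1
        refine Finset.sum_nbij' (sr γ) (sr γ) ?_ ?_ ?_ ?_ ?_
        · intro β hβ
          rw [Finset.mem_erase, mem_posF] at hβ ⊢
          refine ⟨fun h => ?_, sr_pos R hγ hβ.2 hβ.1⟩
          have h' := congrArg (sr γ) h
          rw [sr_sr, sr_self] at h'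
          rcases R.pos_partition _ (Δ_Φ R hγ) with h'' | h''
          · exact h''.2 (h' ▸ hβ.2)
          · exact h''.1 (R.Δ_sub hγ)
        · intro β hβ
          rw [Finset.mem_erase, mem_posF] at hβ ⊢
          refine ⟨fun h => ?_, sr_pos R hγ hβ.2 hβ.1⟩
          have h' := congrArg (sr γ) h
          rw [sr_sr, sr_self] at h'
          rcases R.pos_partition _ (Δ_Φ R hγ) with h'' | h''
          · exact h''.2 (h' ▸ hβ.2)
          · exact h''.1 (R.Δ_sub hγ)
        · intro β _; exact sr_sr γ β
        · intro β _; exact sr_sr γ β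
        · intro β hβ
          rw [Finset.mem_erase, mem_posF] at hβ
          have hci := cover_iff R hs hγ hl hβ.2 hβ.1
          have e2 : sr (sr γ β) * (sr γ * wp L) = sr γ * (sr β * wp L) := by
            rw [sr_conj]; simp only [mul_assoc]
            rw [← mul_assoc (sr γ) (sr γ), sr_mul_self, one_mul]
          have hsb : Simp R (sr β * wp L) := (simp_sr_pos R hβ.2).mul R hs
          by_cases h1 : R.len (wp L) = R.len (sr β * wp L) + 1
          · have t3 : covTerm R (wp L) c f β =
                corootPair β ((sr β * wp L) c) • R.Aop (sr β * wp L) f := by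
              rw [covTerm, if_pos h1]
            rw [t3, demazure_smul hγ0]
            obtain ⟨M, hM, hMw⟩ := exists_Red R hsb
            have hMl : M.length + 1 = L.length := by rw [hM.2, hMw, hL'.2, h1]
            rcases len_dichotomy R hsb hγ with h2 | h2
            · rw [covTerm, if_pos (hci.2 ⟨h1, h2⟩), e2]
              congr 1
              · exact (corootPair_sr γ β _).symm
              · have hr := hM.cons R hγ (by rw [hMw]; exact h2)
                have q1 := ihb M hM (by omega)
                have q2 := ihb _ hr (by simp; omega)
                rw [wp_cons, hMw] at q2
                rw [hMw] at q1
                rw [q1, q2]; rfl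
            · rw [covTerm, if_neg (fun h => by have := (hci.1 h).2; omega)]
              obtain ⟨K, hK, hKw⟩ := exists_Red R ((simp_sr R hγ).mul R hsb)
              have e3 : sr γ * (sr γ * (sr β * wp L)) = sr β * wp L := by
                rw [← mul_assoc, sr_mul_self, one_mul]
              have hr := hK.cons R hγ (by rw [hKw, e3]; exact h2)
              have hrl : (γ :: K).length = M.length := by
                rw [hr.2, hM.2, wp_cons, hKw, e3, hMw]
              have q := ihb _ hr (by omega)
              rw [wp_cons, hKw, e3] at q
              rw [q, dw_cons, demazure_demazure hγ0, smul_zero]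
          · rw [covTerm, if_neg h1, demazure_zero hγ0, covTerm, if_neg (fun h => h1 (hci.1 h).1)]
    refine ⟨ha, ?_⟩
    intro L hL hlen
    obtain ⟨L', h1, h2, h3⟩ := Aop_eq_some R hL.simp
    rw [h3]
    have hll : L'.length = L.length := by rw [h1.2, h2, hL.2]
    by_cases hnil : L = []
    · subst hnil
      rw [List.length_eq_zero_iff.1 hll]
    have hnil' : L' ≠ [] := by
      rintro rfl
      exact hnil (List.length_eq_zero_iff.1 hll.symm)
    funext f
    induction f using MvPolynomial.induction_on with
    | C a => rw [dw_C (h1.ne R) a hnil', dw_C (hL.ne R) a hnil]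
    | add p q hp hq => rw [dw_add (h1.ne R), dw_add (hL.ne R), hp, hq]
    | mul_X p i hp =>
      rw [mul_comm, ← toPoly_single, ha L hL hlen, ha L' h1 (by omega), h2, hp]

theorem covers_iff (w w' : (E n) ≃ₗ[ℝ] (E n)) (α : E n) :
    R.Covers w' α w ↔ α ∈ R.pos ∧ w' = sr α * w ∧ R.len w = R.len w' + 1 := by
  unfold RootData.Covers
  have : (∀ x, (w * w'⁻¹) x = reflectRoot α x) ↔ w' = sr α * w := by
    constructor
    · intro h
      have h1 : w * w'⁻¹ = sr α := by ext1 x; exact h x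
      rw [← sr_inv, ← h1]; group
    · rintro rfl x
      rw [mul_inv_rev, sr_inv, ← mul_assoc, mul_inv_cancel, one_mul]; rfl
  rw [this]

theorem finsum_eq (w : (E n) ≃ₗ[ℝ] (E n)) (c : E n) (f : MvPolynomial (Fin n) ℝ) :
    (∑ᶠ p ∈ {p : ((E n) ≃ₗ[ℝ] (E n)) × (E n) | R.Covers p.1 p.2 w},
        corootPair p.2 (p.1 c) • polyAct w⁻¹ (R.Aop p.1 f)) =
      polyAct w⁻¹ (∑ α ∈ posF R, covTerm R w c f α) := by
  have hset : {p : ((E n) ≃ₗ[ℝ] (E n)) × (E n) | R.Covers p.1 p.2 w} =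
      ↑(((posF R).filter fun α => R.len w = R.len (sr α * w) + 1).image
        fun α => (sr α * w, α)) := by
    ext ⟨w', α⟩
    simp only [Set.mem_ofPred_eq, covers_iff, Finset.coe_image, Finset.coe_filter, Set.mem_image,
      mem_posF, Prod.mk.injEq]
    constructor
    · rintro ⟨h1, rfl, h3⟩
      exact ⟨α, ⟨h1, h3⟩, rfl, rfl⟩
    · rintro ⟨β, ⟨h1, h2⟩, rfl, rfl⟩
      exact ⟨h1, rfl, h2⟩
  rw [hset, finsum_mem_coe_finset, Finset.sum_image (by
    intro a _ b _ h; exact (Prod.mk.inj h).2), map_sum, Finset.sum_filter]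
  refine Finset.sum_congr rfl fun α _ => ?_
  rw [covTerm]
  split_ifs
  · rw [map_smul]
  · rw [map_zero]

end BGGAux

/-- for every χ ∈ S^1 (represented by c ∈ ℝ^n) and w ∈ W, the commutator
[w⁻¹∘A_w, χ·] equals Σ over Bruhat coverings w' →_α w of α̌(w'(χ))·(w⁻¹ ∘ A_{w'}). -/
theorem bgg_commutator_formula {n : ℕ} (R : RootData n)
    (c : EuclideanSpace ℝ (Fin n))
    (w : EuclideanSpace ℝ (Fin n) ≃ₗ[ℝ] EuclideanSpace ℝ (Fin n)) (hw : w ∈ R.W)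
    (f : MvPolynomial (Fin n) ℝ) :
    polyAct w⁻¹ (R.Aop w (toPoly c * f)) - toPoly c * polyAct w⁻¹ (R.Aop w f) =
      ∑ᶠ p ∈ {p : (EuclideanSpace ℝ (Fin n) ≃ₗ[ℝ] EuclideanSpace ℝ (Fin n)) ×
            EuclideanSpace ℝ (Fin n) | R.Covers p.1 p.2 w},
        corootPair p.2 (p.1 c) • polyAct w⁻¹ (R.Aop p.1 f) := by
  obtain ⟨L, hL, hLw⟩ := BGGAux.exists_Red R (BGGAux.simp_of_W R hw)
  obtain ⟨ha, hb⟩ := BGGAux.dw_main R L.length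
  have hA := hb L hL le_rfl
  have hm := ha L hL le_rfl c f
  rw [← hA, hLw] at hm
  rw [BGGAux.finsum_eq, hm, map_add, map_mul, BGGAux.polyAct_toPoly]
  have : w⁻¹ (w c) = c := w.symm_apply_apply c
  rw [this, add_sub_cancel_left]
end

section
/- Fix w ∈ W of length t, linear forms χ_1,…,χ_s ∈ S^1 with s ≤ t, and σ ∈ S homogeneous of degree t−s. Then A_w(χ_1⋯χ_s·σ) = Σ over chains u_1 →_{β_1} u_2 →_{β_2} ⋯ u_s →_{β_s} w in the Bruhat order of the product β̌_1(u_1(χ_1))⋯β̌_s(u_s(χ_s))·A_{u_1}(σ). -/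
open scoped RealInnerProductSpace

attribute [local instance] Classical.propDecidable

/-! ### Basic linear algebra of reflections -/

section BGGAux

variable {n : ℕ}

theorem bgg_reflect_add (γ x y : EuclideanSpace ℝ (Fin n)) :
    reflectRoot γ (x + y) = reflectRoot γ x + reflectRoot γ y := by
  simp only [reflectRoot, inner_add_left, mul_add, add_div, add_smul]
  abel

theorem bgg_reflect_smul (γ : EuclideanSpace ℝ (Fin n)) (c : ℝ) (x : EuclideanSpace ℝ (Fin n)) :
    reflectRoot γ (c • x) = c • reflectRoot γ x := by
  simp only [reflectRoot, inner_smul_left, smul_sub, smul_smul]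
  congr 2
  simp
  ring

theorem bgg_reflect_invol (γ x : EuclideanSpace ℝ (Fin n)) :
    reflectRoot γ (reflectRoot γ x) = x := by
  by_cases h : γ = 0
  · subst h; simp [reflectRoot]
  · have h0 : (⟪γ, γ⟫ : ℝ) ≠ 0 := by simpa using h
    have : (⟪reflectRoot γ x, γ⟫ : ℝ) = - ⟪x, γ⟫ := by
      simp only [reflectRoot, inner_sub_left, inner_smul_left]
      simp only [conj_trivial]
      field_simp
      ring
    rw [reflectRoot, this, reflectRoot, sub_sub, ← add_smul]
    ring_nf
    simp

/-- The reflection as a linear equivalence. -/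
noncomputable def bggSr (γ : EuclideanSpace ℝ (Fin n)) :
    EuclideanSpace ℝ (Fin n) ≃ₗ[ℝ] EuclideanSpace ℝ (Fin n) :=
  LinearEquiv.ofInvolutive
    { toFun := reflectRoot γ
      map_add' := bgg_reflect_add γ
      map_smul' := bgg_reflect_smul γ } (bgg_reflect_invol γ)

theorem bggSr_apply (γ x : EuclideanSpace ℝ (Fin n)) : bggSr γ x = reflectRoot γ x := rfl

theorem bggSr_apply' (γ x : EuclideanSpace ℝ (Fin n)) :
    bggSr γ x = x - corootPair γ x • γ := rfl

theorem bggSr_sq (γ x : EuclideanSpace ℝ (Fin n)) : bggSr γ (bggSr γ x) = x :=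
  bgg_reflect_invol γ x

theorem bggSr_mul_self (γ : EuclideanSpace ℝ (Fin n)) : bggSr γ * bggSr γ = 1 := by
  ext1 x; exact bggSr_sq γ x

theorem bggSr_inv (γ : EuclideanSpace ℝ (Fin n)) : (bggSr γ)⁻¹ = bggSr γ :=
  inv_eq_of_mul_eq_one_left (bggSr_mul_self γ)

theorem bgg_mul_cancel (γ : EuclideanSpace ℝ (Fin n))
    (u : EuclideanSpace ℝ (Fin n) ≃ₗ[ℝ] EuclideanSpace ℝ (Fin n)) :
    bggSr γ * (bggSr γ * u) = u := by
  rw [← mul_assoc, bggSr_mul_self, one_mul]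

theorem bggSr_inner (γ x y : EuclideanSpace ℝ (Fin n)) :
    (⟪bggSr γ x, bggSr γ y⟫ : ℝ) = ⟪x, y⟫ := by
  by_cases h : γ = 0
  · subst h; simp [bggSr_apply, reflectRoot]
  · have h0 : (⟪γ, γ⟫ : ℝ) ≠ 0 := by simpa using h
    simp only [bggSr_apply, reflectRoot, inner_sub_left, inner_smul_left, inner_sub_right,
      inner_smul_right, conj_trivial, real_inner_comm γ]
    rw [real_inner_comm y γ]
    field_simp
    ring

theorem bgg_coroot_inv (γ β x : EuclideanSpace ℝ (Fin n)) :
    corootPair (bggSr γ β) (bggSr γ x) = corootPair β x := by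
  simp only [corootPair, bggSr_inner]

theorem bggSr_conj (γ β : EuclideanSpace ℝ (Fin n)) :
    bggSr (bggSr γ β) * bggSr γ = bggSr γ * bggSr β := by
  ext1 x
  simp only [LinearEquiv.mul_apply]
  rw [bggSr_apply' (bggSr γ β), bgg_coroot_inv, bggSr_apply' β, map_sub, map_smul]

theorem bggSr_self {γ : EuclideanSpace ℝ (Fin n)} (h : γ ≠ 0) : bggSr γ γ = -γ := by
  have h0 : (⟪γ, γ⟫ : ℝ) ≠ 0 := by simpa using h
  simp only [bggSr_apply, reflectRoot]
  rw [mul_div_assoc, div_self h0, mul_one, two_smul]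
  abel

theorem bggSr_neg (γ : EuclideanSpace ℝ (Fin n)) : bggSr (-γ) = bggSr γ := by
  ext1 x
  simp [bggSr_apply, reflectRoot, neg_div]

theorem bgg_eq_sr {γ : EuclideanSpace ℝ (Fin n)}
    {u : EuclideanSpace ℝ (Fin n) ≃ₗ[ℝ] EuclideanSpace ℝ (Fin n)} :
    (∀ x, u x = reflectRoot γ x) ↔ u = bggSr γ :=
  ⟨fun h => LinearEquiv.ext h, fun h x => by rw [h]; rfl⟩

/-! ### Words -/

/-- The product of reflections along a word. -/
noncomputable def bggP (L : List (EuclideanSpace ℝ (Fin n))) :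
    EuclideanSpace ℝ (Fin n) ≃ₗ[ℝ] EuclideanSpace ℝ (Fin n) :=
  (L.map bggSr).prod

theorem bggP_nil : bggP ([] : List (EuclideanSpace ℝ (Fin n))) = 1 := rfl

theorem bggP_cons (γ : EuclideanSpace ℝ (Fin n)) (L : List (EuclideanSpace ℝ (Fin n))) :
    bggP (γ :: L) = bggSr γ * bggP L := by simp [bggP]

theorem bgg_isWordFor (R : RootData n) (L : List (EuclideanSpace ℝ (Fin n)))
    (w : EuclideanSpace ℝ (Fin n) ≃ₗ[ℝ] EuclideanSpace ℝ (Fin n)) :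
    R.IsWordFor L w ↔ bggP L = w := by
  have key : ∀ (L : List (EuclideanSpace ℝ (Fin n))) Ls,
      List.Forall₂ (fun γ (σ : EuclideanSpace ℝ (Fin n) ≃ₗ[ℝ] EuclideanSpace ℝ (Fin n)) =>
        ∀ x, σ x = reflectRoot γ x) L Ls ↔ Ls = L.map bggSr := by
    intro L
    induction L with
    | nil => intro Ls; simp
    | cons γ L ih =>
      intro Ls
      cases Ls with
      | nil => simp
      | cons u Ls => rw [List.forall₂_cons, ih, bgg_eq_sr, List.map_cons, List.cons.injEq]
  simp only [RootData.IsWordFor, key, exists_eq_left, bggP]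

theorem bgg_len_set (R : RootData n)
    (w : EuclideanSpace ℝ (Fin n) ≃ₗ[ℝ] EuclideanSpace ℝ (Fin n)) (k : ℕ) :
    (∃ Ls : List (EuclideanSpace ℝ (Fin n) ≃ₗ[ℝ] EuclideanSpace ℝ (Fin n)),
    Ls.length = k ∧ (∀ σ ∈ Ls, ∃ γ ∈ R.Δ, ∀ x, σ x = reflectRoot γ x) ∧ Ls.prod = w) ↔
    ∃ L : List (EuclideanSpace ℝ (Fin n)), L.length = k ∧ (∀ γ ∈ L, γ ∈ R.Δ) ∧ bggP L = w := by
  constructor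
  · rintro ⟨Ls, h1, h2, h3⟩
    have : ∃ L : List (EuclideanSpace ℝ (Fin n)), (∀ γ ∈ L, γ ∈ R.Δ) ∧ Ls = L.map bggSr := by
      clear h1 h3
      induction Ls with
      | nil => exact ⟨[], by simp, rfl⟩
      | cons u Ls ih =>
        obtain ⟨L, hL, rfl⟩ := ih (fun σ hσ => h2 σ (List.mem_cons_of_mem _ hσ))
        obtain ⟨γ, hγ, hu⟩ := h2 u List.mem_cons_self
        rw [bgg_eq_sr] at hu
        exact ⟨γ :: L, by simpa using ⟨hγ, hL⟩, by simp [hu]⟩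
    obtain ⟨L, hL, rfl⟩ := this
    exact ⟨L, by simpa using h1, hL, h3⟩
  · rintro ⟨L, h1, h2, h3⟩
    refine ⟨L.map bggSr, by simpa using h1, ?_, h3⟩
    intro σ hσ
    obtain ⟨γ, hγ, rfl⟩ := List.mem_map.1 hσ
    exact ⟨γ, h2 γ hγ, fun x => rfl⟩

theorem bgg_len_le (R : RootData n) {L : List (EuclideanSpace ℝ (Fin n))}
    (hL : ∀ γ ∈ L, γ ∈ R.Δ) : R.len (bggP L) ≤ L.length := by
  apply Nat.sInf_le
  exact (bgg_len_set R _ _).2 ⟨L, rfl, hL, rfl⟩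

theorem bgg_exists_reduced (R : RootData n) {L : List (EuclideanSpace ℝ (Fin n))}
    (hL : ∀ γ ∈ L, γ ∈ R.Δ) :
    ∃ M : List (EuclideanSpace ℝ (Fin n)), (∀ γ ∈ M, γ ∈ R.Δ) ∧ bggP M = bggP L ∧
      M.length = R.len (bggP L) := by
  have := Nat.sInf_mem (s := {k | ∃ Ls : List (EuclideanSpace ℝ (Fin n) ≃ₗ[ℝ] EuclideanSpace ℝ (Fin n)),
    Ls.length = k ∧ (∀ σ ∈ Ls, ∃ γ ∈ R.Δ, ∀ x, σ x = reflectRoot γ x) ∧ Ls.prod = bggP L})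
    ⟨L.length, (bgg_len_set R _ _).2 ⟨L, rfl, hL, rfl⟩⟩
  obtain ⟨M, h1, h2, h3⟩ := (bgg_len_set R _ _).1 this
  exact ⟨M, h2, h3, h1⟩

/-! ### Positive roots -/

theorem bgg_functional (R : RootData n) (g : EuclideanSpace ℝ (Fin n) → ℝ) :
    ∃ φ : EuclideanSpace ℝ (Fin n) →ₗ[ℝ] ℝ, ∀ a ∈ R.Δ, φ a = g a := by
  let b := Module.Basis.extend R.simple_indep.linearIndepOn_id
  refine ⟨b.constr ℝ (fun i => g i), fun a ha => ?_⟩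
  have hmem : a ∈ R.simple_indep.linearIndepOn_id.extend (Set.subset_univ _) :=
    Module.Basis.subset_extend _ (by simpa using ha)
  have : b ⟨a, hmem⟩ = a := Module.Basis.extend_apply_self _ _
  conv_lhs => rw [← this]
  rw [Module.Basis.constr_basis]

theorem bgg_neg_mem (R : RootData n) {γ} (h : γ ∈ R.Φ) : -γ ∈ R.Φ := by
  have := R.reflect_mem γ h γ h
  rwa [← bggSr_apply, bggSr_self (R.nonzero γ h)] at this

theorem bgg_pos_or (R : RootData n) {γ} (h : γ ∈ R.Φ) : γ ∈ R.pos ∨ -γ ∈ R.pos := by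
  rcases R.pos_partition γ h with h | h
  · exact Or.inl h.1
  · exact Or.inr h.2

theorem bgg_neg_not_pos (R : RootData n) {γ} (h : γ ∈ R.pos) : -γ ∉ R.pos := by
  rcases R.pos_partition γ (R.pos_sub h) with h' | h'
  · exact h'.2
  · exact absurd h h'.1

theorem bgg_pos_nonneg (R : RootData n) {γ} (h : γ ∈ R.pos)
    (φ : EuclideanSpace ℝ (Fin n) →ₗ[ℝ] ℝ) (hφ : ∀ a ∈ R.Δ, 0 ≤ φ a) : 0 ≤ φ γ := by
  obtain ⟨c, hc, hc0, rfl⟩ := R.pos_combo γ h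
  rw [Finsupp.sum, map_sum]
  refine Finset.sum_nonneg fun a ha => ?_
  rw [map_smul, smul_eq_mul]
  exact mul_nonneg (hc0 a) (hφ a (hc ha))

/-- A simple reflection permutes the positive roots other than the simple root itself. -/
theorem bgg_simple_perm (R : RootData n) {γ α} (hγ : γ ∈ R.Δ) (hα : α ∈ R.pos) (hne : α ≠ γ) :
    bggSr γ α ∈ R.pos := by
  have hγΦ := R.pos_sub (R.Δ_sub hγ)
  rcases bgg_pos_or R (R.reflect_mem γ hγΦ α (R.pos_sub hα)) with h | h
  · exact h
  exfalso
  obtain ⟨c, hc, hc0, hsum⟩ := R.pos_combo α hα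
  by_cases hex : ∃ a ∈ c.support, a ≠ γ
  · obtain ⟨a, ha, hane⟩ := hex
    obtain ⟨φ, hφ⟩ := bgg_functional R (fun b => if b = a then 1 else 0)
    have h1 : φ α = c a := by
      rw [hsum, Finsupp.sum, map_sum, Finset.sum_eq_single a]
      · rw [map_smul, hφ a (hc ha)]; simp
      · intro b hb hba
        rw [map_smul, hφ b (hc hb)]; simp [hba]
      · intro h; exact absurd ha h
    have h2 : φ γ = 0 := by rw [hφ γ hγ]; simp [Ne.symm hane]
    have h3 := bgg_pos_nonneg R h φ (fun b hb => by rw [hφ b hb]; positivity)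
    rw [← bggSr_apply, bggSr_apply', map_neg, map_sub, map_smul, h1, h2] at h3
    have h4 : c a ≠ 0 := by simpa using ha
    have h5 := lt_of_le_of_ne (hc0 a) (Ne.symm h4)
    simp at h3
    linarith
  · push Not at hex
    have h1 : α = c γ • γ := by
      conv_lhs => rw [hsum]
      rw [Finsupp.sum]
      apply Finset.sum_eq_single γ
      · intro b hb hne; exact absurd (hex b hb) hne
      · intro h
        simp at h
        simp [h]
    have h2 := R.reduced γ hγΦ (c γ) (h1 ▸ R.pos_sub hα)
    rcases h2 with h2 | h2
    · rw [h2, one_smul] at h1; exact hne h1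
    · have := hc0 γ
      linarith

/-- Every reflection is a product of simple reflections. -/
theorem bgg_sr_word (R : RootData n) {α} (hα : α ∈ R.pos) :
    ∃ L : List (EuclideanSpace ℝ (Fin n)), (∀ γ ∈ L, γ ∈ R.Δ) ∧ bggP L = bggSr α := by
  by_contra hcon
  obtain ⟨φ, hφ⟩ := bgg_functional R (fun _ => 1)
  let B : Set (EuclideanSpace ℝ (Fin n)) := {α | α ∈ R.pos ∧
    ¬ ∃ L : List (EuclideanSpace ℝ (Fin n)), (∀ γ ∈ L, γ ∈ R.Δ) ∧ bggP L = bggSr α}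
  have hfin : B.Finite := R.finite.subset (fun x hx => R.pos_sub hx.1)
  obtain ⟨β, hβ, hmin⟩ := Set.exists_min_image B φ hfin ⟨α, hα, hcon⟩
  obtain ⟨hβp, hβn⟩ := hβ
  have hex : ∃ a ∈ R.Δ, 0 < (⟪β, a⟫ : ℝ) := by
    by_contra hno
    push Not at hno
    obtain ⟨c, hc, hc0, hsum⟩ := R.pos_combo β hβp
    have h0 : 0 < (⟪β, β⟫ : ℝ) := by
      rw [real_inner_self_eq_norm_sq]
      have := norm_pos_iff.2 (R.nonzero β (R.pos_sub hβp))
      positivity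
    have : (⟪β, β⟫ : ℝ) ≤ 0 := by
      have e : (⟪β, β⟫ : ℝ) = ⟪β, c.sum fun a t => t • a⟫ := by rw [← hsum]
      rw [e, Finsupp.sum, inner_sum]
      refine Finset.sum_nonpos fun a ha => ?_
      rw [inner_smul_right]
      exact mul_nonpos_of_nonneg_of_nonpos (hc0 a) (hno a (hc ha))
    linarith
  obtain ⟨a, ha, hpos⟩ := hex
  have hne : β ≠ a := by
    rintro rfl
    exact hβn ⟨[β], by simpa using ha, by simp [bggP]⟩
  have hp := bgg_simple_perm R ha hβp hne
  have haa : 0 < (⟪a, a⟫ : ℝ) := by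
    rw [real_inner_self_eq_norm_sq]
    have := norm_pos_iff.2 (R.nonzero a (R.pos_sub (R.Δ_sub ha)))
    positivity
  have hlt : φ (bggSr a β) < φ β := by
    rw [bggSr_apply', map_sub, map_smul, hφ a ha, corootPair]
    have : 0 < 2 * (⟪β, a⟫ : ℝ) / ⟪a, a⟫ := by positivity
    simp only [smul_eq_mul, mul_one]
    linarith
  have hw : ∃ L : List (EuclideanSpace ℝ (Fin n)), (∀ γ ∈ L, γ ∈ R.Δ) ∧
      bggP L = bggSr (bggSr a β) := by
    by_contra h
    exact absurd (hmin _ ⟨hp, h⟩) (not_le.2 hlt)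
  obtain ⟨L, hL, hPL⟩ := hw
  refine hβn ⟨a :: (L ++ [a]), ?_, ?_⟩
  · intro γ hγ
    simp at hγ
    rcases hγ with rfl | h | rfl
    · exact ha
    · exact hL _ h
    · exact ha
  · have : bggP (a :: (L ++ [a])) = bggSr a * (bggP L * bggSr a) := by simp [bggP]
    rw [this, hPL, bggSr_conj, bgg_mul_cancel]

theorem bggP_append (L M : List (EuclideanSpace ℝ (Fin n))) :
    bggP (L ++ M) = bggP L * bggP M := by simp [bggP]

theorem bggP_reverse (L : List (EuclideanSpace ℝ (Fin n))) :
    bggP L.reverse = (bggP L)⁻¹ := by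
  induction L with
  | nil => simp [bggP]
  | cons a L ih =>
    rw [List.reverse_cons, bggP_append, ih, bggP_cons a L, mul_inv_rev, bggSr_inv]
    simp [bggP]

theorem bgg_W_word (R : RootData n)
    {w : EuclideanSpace ℝ (Fin n) ≃ₗ[ℝ] EuclideanSpace ℝ (Fin n)} (hw : w ∈ R.W) :
    ∃ L : List (EuclideanSpace ℝ (Fin n)), (∀ γ ∈ L, γ ∈ R.Δ) ∧ bggP L = w := by
  unfold RootData.W at hw
  induction hw using Subgroup.closure_induction with
  | mem u hu =>
    obtain ⟨γ, hγ, h⟩ := hu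
    rw [bgg_eq_sr] at h
    subst h
    rcases bgg_pos_or R hγ with h | h
    · exact bgg_sr_word R h
    · rw [← bggSr_neg]; exact bgg_sr_word R h
  | one => exact ⟨[], by simp, rfl⟩
  | mul x y _ _ hx hy =>
    obtain ⟨L, hL, rfl⟩ := hx
    obtain ⟨M, hM, rfl⟩ := hy
    refine ⟨L ++ M, ?_, bggP_append L M⟩
    intro γ hγ
    rcases List.mem_append.1 hγ with h | h
    · exact hL _ h
    · exact hM _ h
  | inv x _ hx =>
    obtain ⟨L, hL, rfl⟩ := hx
    exact ⟨L.reverse, fun γ hγ => hL _ (List.mem_reverse.1 hγ), bggP_reverse L⟩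

/-! ### Deleting letters from words -/

/-- All pairs (reflection root, word with a letter deleted). -/
noncomputable def bggTri : List (EuclideanSpace ℝ (Fin n)) →
    List (EuclideanSpace ℝ (Fin n) × List (EuclideanSpace ℝ (Fin n)))
  | [] => []
  | γ :: L => (γ, L) :: (bggTri L).map (fun p => (bggSr γ p.1, γ :: p.2))

theorem bggTri_spec (R : RootData n) (L : List (EuclideanSpace ℝ (Fin n)))
    (hL : ∀ γ ∈ L, γ ∈ R.Δ) : ∀ p ∈ bggTri L,
      (∀ γ ∈ p.2, γ ∈ R.Δ) ∧ p.2.length + 1 = L.length ∧ bggP p.2 = bggSr p.1 * bggP L := by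
  induction L with
  | nil => simp [bggTri]
  | cons γ L ih =>
    intro p hp
    have hL' : ∀ γ ∈ L, γ ∈ R.Δ := fun a ha => hL a (List.mem_cons_of_mem _ ha)
    rw [bggTri, List.mem_cons, List.mem_map] at hp
    rcases hp with rfl | ⟨q, hq, rfl⟩
    · exact ⟨hL', rfl, by rw [bggP_cons, bgg_mul_cancel]⟩
    · obtain ⟨h1, h2, h3⟩ := ih hL' q hq
      refine ⟨?_, by simp [← h2], ?_⟩
      · intro a ha
        rcases List.mem_cons.1 ha with rfl | ha
        · exact hL _ List.mem_cons_self
        · exact h1 a ha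
      · simp only [bggP_cons]
        rw [h3, ← mul_assoc, ← mul_assoc, bggSr_conj]

theorem bgg_inv_apply_cons (γ x : EuclideanSpace ℝ (Fin n))
    (u : EuclideanSpace ℝ (Fin n) ≃ₗ[ℝ] EuclideanSpace ℝ (Fin n)) :
    (bggSr γ * u)⁻¹ x = u⁻¹ (bggSr γ x) := by
  rw [mul_inv_rev, bggSr_inv]; rfl

/-- Strong exchange. -/
theorem bgg_exchange (R : RootData n) (L : List (EuclideanSpace ℝ (Fin n)))
    (hL : ∀ γ ∈ L, γ ∈ R.Δ) : ∀ α ∈ R.pos, (bggP L)⁻¹ α ∉ R.pos →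
      ∃ M, (α, M) ∈ bggTri L := by
  induction L with
  | nil => intro α hα h; exact absurd hα h
  | cons γ L ih =>
    intro α hα h
    have hL' : ∀ γ ∈ L, γ ∈ R.Δ := fun a ha => hL a (List.mem_cons_of_mem _ ha)
    by_cases hne : α = γ
    · subst hne
      exact ⟨L, by simp [bggTri]⟩
    · rw [bggP_cons, bgg_inv_apply_cons] at h
      obtain ⟨M, hM⟩ := ih hL' _ (bgg_simple_perm R (hL γ List.mem_cons_self) hα hne) h
      refine ⟨γ :: M, ?_⟩
      rw [bggTri]
      refine List.mem_cons_of_mem _ (List.mem_map.2 ⟨_, hM, ?_⟩)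
      simp [bggSr_sq]

theorem bgg_exists_word_sr_mul (R : RootData n) {L : List (EuclideanSpace ℝ (Fin n))}
    (hL : ∀ γ ∈ L, γ ∈ R.Δ) {α} (hα : α ∈ R.pos) :
    ∃ M : List (EuclideanSpace ℝ (Fin n)), (∀ γ ∈ M, γ ∈ R.Δ) ∧ bggP M = bggSr α * bggP L := by
  obtain ⟨K, hK, hPK⟩ := bgg_sr_word R hα
  refine ⟨K ++ L, ?_, by rw [bggP_append, hPK]⟩
  intro γ hγ
  rcases List.mem_append.1 hγ with h | h
  · exact hK _ h
  · exact hL _ h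

theorem bgg_len_lt_of_not_pos (R : RootData n) {L : List (EuclideanSpace ℝ (Fin n))}
    (hL : ∀ γ ∈ L, γ ∈ R.Δ) {α} (hα : α ∈ R.pos) (h : (bggP L)⁻¹ α ∉ R.pos) :
    R.len (bggSr α * bggP L) < R.len (bggP L) := by
  obtain ⟨M, hM, hPM, hlen⟩ := bgg_exists_reduced R hL
  rw [← hPM] at h
  obtain ⟨K, hK⟩ := bgg_exchange R M hM α hα h
  obtain ⟨h1, h2, h3⟩ := bggTri_spec R M hM _ hK
  have := bgg_len_le R h1
  simp only at h2 h3
  rw [h3, hPM] at this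
  simp only at this
  omega

theorem bgg_inv_mem (R : RootData n) {L : List (EuclideanSpace ℝ (Fin n))}
    (hL : ∀ γ ∈ L, γ ∈ R.Δ) : ∀ {α}, α ∈ R.Φ → (bggP L)⁻¹ α ∈ R.Φ := by
  induction L with
  | nil => intro α h; exact h
  | cons γ L ih =>
    intro α h
    rw [bggP_cons, bgg_inv_apply_cons]
    exact ih (fun a ha => hL a (List.mem_cons_of_mem _ ha))
      (R.reflect_mem γ (R.pos_sub (R.Δ_sub (hL γ List.mem_cons_self))) α h)

theorem bgg_len_gt_of_pos (R : RootData n) {L : List (EuclideanSpace ℝ (Fin n))}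
    (hL : ∀ γ ∈ L, γ ∈ R.Δ) {α} (hα : α ∈ R.pos) (h : (bggP L)⁻¹ α ∈ R.pos) :
    R.len (bggP L) < R.len (bggSr α * bggP L) := by
  obtain ⟨M, hM, hPM⟩ := bgg_exists_word_sr_mul R hL hα
  have h1 : (bggP M)⁻¹ α ∉ R.pos := by
    rw [hPM, bgg_inv_apply_cons, bggSr_self (R.nonzero α (R.pos_sub hα)), map_neg]
    exact bgg_neg_not_pos R h
  have := bgg_len_lt_of_not_pos R hM hα h1
  rwa [hPM, bgg_mul_cancel] at this

theorem bgg_tail_reduced (R : RootData n) {γ} {L : List (EuclideanSpace ℝ (Fin n))}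
    (hL : ∀ a ∈ γ :: L, a ∈ R.Δ) (hr : R.len (bggP (γ :: L)) = L.length + 1) :
    R.len (bggP L) = L.length := by
  have hL' : ∀ γ ∈ L, γ ∈ R.Δ := fun a ha => hL a (List.mem_cons_of_mem _ ha)
  obtain ⟨M, hM, hPM, hlen⟩ := bgg_exists_reduced R hL'
  have h1 := bgg_len_le R hL'
  have h2 : R.len (bggP (γ :: M)) ≤ (γ :: M).length := by
    apply bgg_len_le
    intro a ha
    rcases List.mem_cons.1 ha with rfl | ha
    · exact hL _ List.mem_cons_self
    · exact hM a ha
  rw [bggP_cons, hPM, ← bggP_cons, List.length_cons] at h2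
  omega

theorem bggTri_pos_nodup (R : RootData n) (L : List (EuclideanSpace ℝ (Fin n)))
    (hL : ∀ γ ∈ L, γ ∈ R.Δ) (hr : R.len (bggP L) = L.length) :
    (∀ p ∈ bggTri L, p.1 ∈ R.pos) ∧ ((bggTri L).map Prod.fst).Nodup := by
  induction L with
  | nil => simp [bggTri]
  | cons γ L ih =>
    have hL' : ∀ γ ∈ L, γ ∈ R.Δ := fun a ha => hL a (List.mem_cons_of_mem _ ha)
    have hγ := hL γ List.mem_cons_self
    obtain ⟨ih1, ih2⟩ := ih hL' (bgg_tail_reduced R hL hr)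
    constructor
    · intro p hp
      rw [bggTri, List.mem_cons, List.mem_map] at hp
      rcases hp with rfl | ⟨q, hq, rfl⟩
      · exact R.Δ_sub hγ
      · refine bgg_simple_perm R hγ (ih1 q hq) ?_
        intro he
        obtain ⟨h1, h2, h3⟩ := bggTri_spec R L hL' q hq
        have h4 := bgg_len_le R h1
        rw [h3, he, ← bggP_cons, hr, List.length_cons] at h4
        omega
    · rw [bggTri, List.map_cons, List.nodup_cons]
      constructor
      · intro hmem
        rw [List.map_map, List.mem_map] at hmem
        obtain ⟨q, hq, he⟩ := hmem
        simp only [Function.comp_apply] at he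
        have h5 : q.1 = -γ := by
          rw [← bggSr_sq γ q.1, he, bggSr_self (R.nonzero γ (R.pos_sub (R.Δ_sub hγ)))]
        exact bgg_neg_not_pos R (R.Δ_sub hγ) (h5 ▸ ih1 q hq)
      · have : List.map Prod.fst (List.map (fun p : EuclideanSpace ℝ (Fin n) ×
            List (EuclideanSpace ℝ (Fin n)) => (bggSr γ p.1, γ :: p.2)) (bggTri L)) =
            ((bggTri L).map Prod.fst).map (bggSr γ) := by
          rw [List.map_map, List.map_map]; rfl
        rw [this]
        exact ih2.map (bggSr γ).injective

/-! ### Demazure operators -/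

theorem bgg_toPoly_add (u v : EuclideanSpace ℝ (Fin n)) :
    toPoly (u + v) = toPoly u + toPoly v := by
  simp [toPoly, add_mul, Finset.sum_add_distrib]

theorem bgg_toPoly_smul (c : ℝ) (v : EuclideanSpace ℝ (Fin n)) :
    toPoly (c • v) = MvPolynomial.C c * toPoly v := by
  simp [toPoly, Finset.mul_sum, mul_assoc]

/-- `toPoly` as a linear map. -/
noncomputable def bggToPolyL : EuclideanSpace ℝ (Fin n) →ₗ[ℝ] MvPolynomial (Fin n) ℝ where
  toFun := toPoly
  map_add' := bgg_toPoly_add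
  map_smul' c v := by rw [bgg_toPoly_smul, MvPolynomial.C_mul']; rfl

theorem bgg_toPoly_sub (u v : EuclideanSpace ℝ (Fin n)) :
    toPoly (u - v) = toPoly u - toPoly v := map_sub bggToPolyL u v

theorem bgg_toPoly_single (i : Fin n) :
    toPoly (EuclideanSpace.single i (1 : ℝ)) = MvPolynomial.X i := by
  rw [toPoly, Finset.sum_eq_single i]
  · simp
  · intro j _ hj; simp [hj]
  · simp

theorem bgg_toPoly_ne_zero {γ : EuclideanSpace ℝ (Fin n)} (h : γ ≠ 0) : toPoly γ ≠ 0 := by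
  intro h0
  apply h
  ext i
  have := congrArg (MvPolynomial.eval (fun j => if j = i then (1 : ℝ) else 0)) h0
  simpa [toPoly] using this

theorem bgg_decomp (v : EuclideanSpace ℝ (Fin n)) :
    v = ∑ i, v i • EuclideanSpace.single i (1 : ℝ) := by
  ext j
  simp [Pi.single_apply]

theorem bgg_refl_toPoly (γ v : EuclideanSpace ℝ (Fin n)) :
    reflPolyAct γ (toPoly v) = toPoly (bggSr γ v) := by
  have h1 : reflPolyAct γ (toPoly v) =
      ∑ i, v i • toPoly (bggSr γ (EuclideanSpace.single i (1 : ℝ))) := by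
    rw [toPoly, map_sum]
    refine Finset.sum_congr rfl fun i _ => ?_
    rw [← MvPolynomial.smul_eq_C_mul, map_smul]
    congr 1
    simp [reflPolyAct, bggSr_apply]
  rw [h1]
  conv_rhs => rw [bgg_decomp v, map_sum]
  change _ = bggToPolyL _
  rw [map_sum]
  refine Finset.sum_congr rfl fun i _ => ?_
  rw [map_smul, map_smul]
  rfl

theorem bgg_dvd (γ : EuclideanSpace ℝ (Fin n)) (f : MvPolynomial (Fin n) ℝ) :
    ∃ q, f - reflPolyAct γ f = toPoly γ * q := by
  induction f using MvPolynomial.induction_on with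
  | C a =>
    refine ⟨0, ?_⟩
    rw [← MvPolynomial.algebraMap_eq, AlgHom.commutes, sub_self, mul_zero]
  | add p q hp hq =>
    obtain ⟨a, ha⟩ := hp
    obtain ⟨b, hb⟩ := hq
    refine ⟨a + b, ?_⟩
    rw [map_add, mul_add, ← ha, ← hb]; ring
  | mul_X p i hp =>
    obtain ⟨a, ha⟩ := hp
    refine ⟨a * MvPolynomial.X i + reflPolyAct γ p *
      MvPolynomial.C (corootPair γ (EuclideanSpace.single i 1)), ?_⟩
    have h1 : reflPolyAct γ (MvPolynomial.X i) = MvPolynomial.X i -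
        MvPolynomial.C (corootPair γ (EuclideanSpace.single i 1)) * toPoly γ := by
      rw [← bgg_toPoly_single, bgg_refl_toPoly, bggSr_apply', bgg_toPoly_sub, bgg_toPoly_smul]
    rw [map_mul, h1]
    linear_combination MvPolynomial.X i * ha

theorem bgg_dem_spec (γ : EuclideanSpace ℝ (Fin n)) (f : MvPolynomial (Fin n) ℝ) :
    f - reflPolyAct γ f = toPoly γ * demazure γ f := by
  rw [demazure, dif_pos (bgg_dvd γ f)]
  exact (bgg_dvd γ f).choose_spec

theorem bgg_dem_unique {γ : EuclideanSpace ℝ (Fin n)} (h : γ ≠ 0) {f q : MvPolynomial (Fin n) ℝ}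
    (hq : f - reflPolyAct γ f = toPoly γ * q) : demazure γ f = q := by
  apply mul_left_cancel₀ (bgg_toPoly_ne_zero h)
  rw [← bgg_dem_spec, hq]

theorem bgg_dem_add {γ : EuclideanSpace ℝ (Fin n)} (h : γ ≠ 0) (f g : MvPolynomial (Fin n) ℝ) :
    demazure γ (f + g) = demazure γ f + demazure γ g := by
  apply bgg_dem_unique h
  rw [map_add, mul_add, ← bgg_dem_spec, ← bgg_dem_spec]; ring

theorem bgg_dem_smul {γ : EuclideanSpace ℝ (Fin n)} (h : γ ≠ 0) (c : ℝ)
    (f : MvPolynomial (Fin n) ℝ) : demazure γ (c • f) = c • demazure γ f := by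
  apply bgg_dem_unique h
  rw [map_smul, mul_smul_comm, ← bgg_dem_spec, smul_sub]

theorem bgg_dem_zero {γ : EuclideanSpace ℝ (Fin n)} (h : γ ≠ 0) :
    demazure γ (0 : MvPolynomial (Fin n) ℝ) = 0 := by
  apply bgg_dem_unique h
  simp

theorem bgg_dem_C {γ : EuclideanSpace ℝ (Fin n)} (h : γ ≠ 0) (a : ℝ) :
    demazure γ (MvPolynomial.C a : MvPolynomial (Fin n) ℝ) = 0 := by
  apply bgg_dem_unique h
  rw [← MvPolynomial.algebraMap_eq, AlgHom.commutes, sub_self, mul_zero]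

theorem bgg_dem_mul {γ : EuclideanSpace ℝ (Fin n)} (h : γ ≠ 0) (χ : EuclideanSpace ℝ (Fin n))
    (f : MvPolynomial (Fin n) ℝ) :
    demazure γ (toPoly χ * f) = toPoly (bggSr γ χ) * demazure γ f + corootPair γ χ • f := by
  apply bgg_dem_unique h
  have h1 := bgg_dem_spec γ f
  have h2 : toPoly (bggSr γ χ) = toPoly χ - MvPolynomial.C (corootPair γ χ) * toPoly γ := by
    rw [bggSr_apply', bgg_toPoly_sub, bgg_toPoly_smul]
  rw [map_mul, bgg_refl_toPoly, h2, MvPolynomial.smul_eq_C_mul]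
  linear_combination (toPoly χ - MvPolynomial.C (corootPair γ χ) * toPoly γ) * h1

theorem bgg_refl_sq (γ : EuclideanSpace ℝ (Fin n)) (f : MvPolynomial (Fin n) ℝ) :
    reflPolyAct γ (reflPolyAct γ f) = f := by
  have : (reflPolyAct γ).comp (reflPolyAct γ) = AlgHom.id ℝ (MvPolynomial (Fin n) ℝ) := by
    apply MvPolynomial.algHom_ext
    intro i
    rw [AlgHom.comp_apply, ← bgg_toPoly_single, bgg_refl_toPoly, bgg_refl_toPoly, bggSr_sq]
    rfl
  exact DFunLike.congr_fun this f

theorem bgg_dem_dem {γ : EuclideanSpace ℝ (Fin n)} (h : γ ≠ 0) (f : MvPolynomial (Fin n) ℝ) :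
    demazure γ (demazure γ f) = 0 := by
  apply bgg_dem_unique h
  rw [mul_zero, sub_eq_zero]
  apply mul_left_cancel₀ (bgg_toPoly_ne_zero h)
  have h1 := bgg_dem_spec γ f
  have h2 := congrArg (reflPolyAct γ) h1
  have h3 : toPoly (-γ) = -toPoly γ := map_neg bggToPolyL γ
  rw [map_sub, bgg_refl_sq, map_mul, bgg_refl_toPoly, bggSr_self h, h3] at h2
  linear_combination -h1 - h2

/-! ### Words of Demazure operators -/

theorem bgg_D_cons (γ : EuclideanSpace ℝ (Fin n)) (L : List (EuclideanSpace ℝ (Fin n)))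
    (f : MvPolynomial (Fin n) ℝ) :
    demazureWord (γ :: L) f = demazure γ (demazureWord L f) := rfl

theorem bgg_D_add {L : List (EuclideanSpace ℝ (Fin n))} (hL : ∀ γ ∈ L, γ ≠ 0)
    (f g : MvPolynomial (Fin n) ℝ) :
    demazureWord L (f + g) = demazureWord L f + demazureWord L g := by
  induction L with
  | nil => rfl
  | cons γ L ih =>
    rw [bgg_D_cons, ih (fun a ha => hL a (List.mem_cons_of_mem _ ha)),
      bgg_dem_add (hL γ List.mem_cons_self)]
    rfl

theorem bgg_D_zero {L : List (EuclideanSpace ℝ (Fin n))} (hL : ∀ γ ∈ L, γ ≠ 0) :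
    demazureWord L (0 : MvPolynomial (Fin n) ℝ) = 0 := by
  have := bgg_D_add hL 0 0
  simpa using this

theorem bgg_D_C {L : List (EuclideanSpace ℝ (Fin n))} (hL : ∀ γ ∈ L, γ ≠ 0) (h0 : 0 < L.length)
    (a : ℝ) : demazureWord L (MvPolynomial.C a : MvPolynomial (Fin n) ℝ) = 0 := by
  induction L with
  | nil => simp at h0
  | cons γ L ih =>
    rw [bgg_D_cons]
    rcases L with _ | ⟨β, L⟩
    · exact bgg_dem_C (hL γ List.mem_cons_self) a
    · rw [ih (fun a ha => hL a (List.mem_cons_of_mem _ ha)) (by simp),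
        bgg_dem_zero (hL γ List.mem_cons_self)]

theorem bgg_dem_list_sum {γ : EuclideanSpace ℝ (Fin n)} (h : γ ≠ 0)
    (K : List (MvPolynomial (Fin n) ℝ)) : demazure γ K.sum = (K.map (demazure γ)).sum := by
  induction K with
  | nil => simpa using bgg_dem_zero h
  | cons a K ih => simp [bgg_dem_add h, ih]

/-- The commutator formula along a word. -/
theorem bgg_leibniz {L : List (EuclideanSpace ℝ (Fin n))} (hL : ∀ γ ∈ L, γ ≠ 0)
    (χ : EuclideanSpace ℝ (Fin n)) (f : MvPolynomial (Fin n) ℝ) :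
    demazureWord L (toPoly χ * f) = toPoly (bggP L χ) * demazureWord L f +
      ((bggTri L).map (fun p => corootPair p.1 (bggP p.2 χ) • demazureWord p.2 f)).sum := by
  induction L with
  | nil => simp [bggTri, demazureWord, bggP]
  | cons γ L ih =>
    have hγ := hL γ List.mem_cons_self
    rw [bgg_D_cons, ih (fun a ha => hL a (List.mem_cons_of_mem _ ha)), bgg_dem_add hγ,
      bgg_dem_mul hγ, bgg_dem_list_sum hγ, bggTri, List.map_cons, List.sum_cons, List.map_map,
      List.map_map, bggP_cons, LinearEquiv.mul_apply, add_assoc]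
    congr 3
    apply List.map_congr_left
    intro p _
    simp only [Function.comp_apply]
    rw [bgg_dem_smul hγ, bggP_cons, LinearEquiv.mul_apply, bgg_coroot_inv]
    rfl

theorem bgg_simple_ne (R : RootData n) {L : List (EuclideanSpace ℝ (Fin n))}
    (hL : ∀ γ ∈ L, γ ∈ R.Δ) : ∀ γ ∈ L, γ ≠ 0 :=
  fun γ hγ => R.nonzero γ (R.pos_sub (R.Δ_sub (hL γ hγ)))

/-! ### Vanishing for degree reasons -/

theorem bgg_vanish_monomial (R : RootData n) (d : ℕ) : ∀ (m : Fin n →₀ ℕ), m.degree = d →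
    ∀ (c : ℝ) (L : List (EuclideanSpace ℝ (Fin n))), (∀ γ ∈ L, γ ∈ R.Δ) → d < L.length →
      demazureWord L (MvPolynomial.monomial m c) = 0 := by
  induction d with
  | zero =>
    intro m hm c L hL hd
    rw [Finsupp.degree_eq_zero_iff] at hm
    subst hm
    exact bgg_D_C (bgg_simple_ne R hL) hd c
  | succ d ih =>
    intro m hm c L hL hd
    have hne : m ≠ 0 := by rintro rfl; simp at hm
    obtain ⟨i, hi⟩ := Finsupp.ne_iff.1 hne
    have hle : Finsupp.single i 1 ≤ m := by
      rw [Finsupp.single_le_iff]; exact Nat.one_le_iff_ne_zero.2 hi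
    obtain ⟨m', rfl⟩ := exists_add_of_le hle
    have hm' : m'.degree = d := by
      rw [map_add, Finsupp.degree_single] at hm; omega
    have e : MvPolynomial.monomial (Finsupp.single i 1 + m') c =
        toPoly (EuclideanSpace.single i (1 : ℝ)) * MvPolynomial.monomial m' c := by
      rw [bgg_toPoly_single, MvPolynomial.X, MvPolynomial.monomial_mul, one_mul]
    rw [e, bgg_leibniz (bgg_simple_ne R hL), ih m' hm' c L hL (by omega), mul_zero, zero_add]
    apply List.sum_eq_zero
    intro x hx
    obtain ⟨p, hp, rfl⟩ := List.mem_map.1 hx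
    obtain ⟨h1, h2, -⟩ := bggTri_spec R L hL p hp
    rw [ih m' hm' c p.2 h1 (by omega), smul_zero]

theorem bgg_vanish (R : RootData n) {d : ℕ} {f : MvPolynomial (Fin n) ℝ}
    (hf : f.IsHomogeneous d) {L : List (EuclideanSpace ℝ (Fin n))} (hL : ∀ γ ∈ L, γ ∈ R.Δ)
    (hd : d < L.length) : demazureWord L f = 0 := by
  rw [← MvPolynomial.support_sum_monomial_coeff f]
  refine Finset.sum_induction _ (fun g => demazureWord L g = 0) ?_ ?_ ?_
  · intro a b ha hb
    rw [bgg_D_add (bgg_simple_ne R hL), ha, hb, add_zero]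
  · exact bgg_D_zero (bgg_simple_ne R hL)
  · intro m hm
    refine bgg_vanish_monomial R d m ?_ _ L hL hd
    have := hf (MvPolynomial.mem_support_iff.1 hm)
    rw [Finsupp.degree_eq_weight_one]
    exact this

/-! ### Independence of the reduced word -/

theorem bgg_Aop_spec (R : RootData n) {L : List (EuclideanSpace ℝ (Fin n))}
    (hL : ∀ γ ∈ L, γ ∈ R.Δ) :
    ∃ M : List (EuclideanSpace ℝ (Fin n)), (∀ γ ∈ M, γ ∈ R.Δ) ∧ bggP M = bggP L ∧
      M.length = R.len (bggP L) ∧ R.Aop (bggP L) = demazureWord M := by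
  have hex : ∃ M, R.IsReducedWord M (bggP L) := by
    obtain ⟨M, h1, h2, h3⟩ := bgg_exists_reduced R hL
    exact ⟨M, h1, h3, (bgg_isWordFor R _ _).2 h2⟩
  obtain ⟨h1, h2, h3⟩ := hex.choose_spec
  refine ⟨hex.choose, h1, (bgg_isWordFor R _ _).1 h3, h2, ?_⟩
  rw [RootData.Aop, dif_pos hex]

theorem bgg_pos_finite (R : RootData n) : R.pos.Finite := R.finite.subset R.pos_sub

/-- The summand of the commutator formula. -/
noncomputable def bggG (R : RootData n)
    (w : EuclideanSpace ℝ (Fin n) ≃ₗ[ℝ] EuclideanSpace ℝ (Fin n))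
    (χ : EuclideanSpace ℝ (Fin n)) (f : MvPolynomial (Fin n) ℝ)
    (β : EuclideanSpace ℝ (Fin n)) : MvPolynomial (Fin n) ℝ :=
  if R.len (bggSr β * w) + 1 = R.len w then
    corootPair β ((bggSr β * w) χ) • R.Aop (bggSr β * w) f else 0

theorem bgg_sum_eq (R : RootData n) (r : ℕ)
    (hT : ∀ L : List (EuclideanSpace ℝ (Fin n)), (∀ γ ∈ L, γ ∈ R.Δ) → L.length = r → ∀ f,
      demazureWord L f = if R.len (bggP L) = r then R.Aop (bggP L) f else 0)
    {L : List (EuclideanSpace ℝ (Fin n))} (hL : ∀ γ ∈ L, γ ∈ R.Δ) (hlen : L.length = r + 1)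
    (hr : R.len (bggP L) = L.length) (χ : EuclideanSpace ℝ (Fin n))
    (f : MvPolynomial (Fin n) ℝ) :
    ((bggTri L).map (fun p => corootPair p.1 (bggP p.2 χ) • demazureWord p.2 f)).sum =
      ∑ β ∈ (bgg_pos_finite R).toFinset, bggG R (bggP L) χ f β := by
  obtain ⟨hpos, hnd⟩ := bggTri_pos_nodup R L hL hr
  have h1 : (bggTri L).map (fun p => corootPair p.1 (bggP p.2 χ) • demazureWord p.2 f) =
      ((bggTri L).map Prod.fst).map (bggG R (bggP L) χ f) := by
    rw [List.map_map]
    apply List.map_congr_left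
    intro p hp
    obtain ⟨a1, a2, a3⟩ := bggTri_spec R L hL p hp
    rw [hT p.2 a1 (by omega), Function.comp_apply, bggG, a3, hr, hlen]
    by_cases hc : R.len (bggSr p.1 * bggP L) = r
    · rw [if_pos hc, if_pos (by omega)]
    · rw [if_neg hc, if_neg (by omega), smul_zero]
  rw [h1, ← List.sum_toFinset _ hnd]
  apply Finset.sum_subset
  · intro β hβ
    rw [List.mem_toFinset, List.mem_map] at hβ
    obtain ⟨p, hp, rfl⟩ := hβ
    simpa using hpos p hp
  · intro β hβ hn
    have hβ' : β ∈ R.pos := by simpa using hβ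
    rw [bggG, if_neg]
    intro hlen'
    by_cases h2 : (bggP L)⁻¹ β ∈ R.pos
    · have := bgg_len_gt_of_pos R hL hβ' h2
      omega
    · obtain ⟨M, hM⟩ := bgg_exchange R L hL β hβ' h2
      exact hn (List.mem_toFinset.2 (List.mem_map.2 ⟨_, hM, rfl⟩))

theorem bgg_main (R : RootData n) (r : ℕ) :
    ∀ L : List (EuclideanSpace ℝ (Fin n)), (∀ γ ∈ L, γ ∈ R.Δ) → L.length = r → ∀ f,
      demazureWord L f = if R.len (bggP L) = r then R.Aop (bggP L) f else 0 := by
  induction r with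
  | zero =>
    intro L hL hlen f
    have h0 := bgg_len_le R hL
    obtain ⟨M, h1, h2, h3, h4⟩ := bgg_Aop_spec R hL
    rw [if_pos (by omega), h4]
    rw [List.length_eq_zero_iff] at hlen
    have : M = [] := by rw [← List.length_eq_zero_iff, h3]; subst hlen; simpa using h0
    rw [this, hlen]
  | succ r ih =>
    intro L hL hlen f
    by_cases hr : R.len (bggP L) = r + 1
    · rw [if_pos hr]
      obtain ⟨M, h1, h2, h3, h4⟩ := bgg_Aop_spec R hL
      rw [h4]
      induction f using MvPolynomial.induction_on with
      | C a =>
        rw [bgg_D_C (bgg_simple_ne R hL) (by omega), bgg_D_C (bgg_simple_ne R h1) (by omega)]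
      | add p q hp hq =>
        rw [bgg_D_add (bgg_simple_ne R hL), bgg_D_add (bgg_simple_ne R h1), hp, hq]
      | mul_X p i hp =>
        rw [mul_comm, ← bgg_toPoly_single, bgg_leibniz (bgg_simple_ne R hL),
          bgg_leibniz (bgg_simple_ne R h1), bgg_sum_eq R r ih hL hlen (by omega),
          bgg_sum_eq R r ih h1 (by omega) (by rw [h2, h3]), h2, hp]
    · rw [if_neg hr]
      rcases L with _ | ⟨γ, M⟩
      · simp at hlen
      have hγ := hL γ List.mem_cons_self
      have hγ0 := bgg_simple_ne R hL γ List.mem_cons_self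
      have hM : ∀ γ ∈ M, γ ∈ R.Δ := fun a ha => hL a (List.mem_cons_of_mem _ ha)
      have hMl : M.length = r := by simpa using hlen
      have hle := bgg_len_le R hL
      rw [bgg_D_cons, ih M hM hMl]
      by_cases hMr : R.len (bggP M) = r
      · rw [if_pos hMr]
        have hn : (bggP M)⁻¹ γ ∉ R.pos := by
          intro hp
          have := bgg_len_gt_of_pos R hM (R.Δ_sub hγ) hp
          rw [← bggP_cons] at this
          omega
        obtain ⟨K, hK⟩ := bgg_exchange R M hM γ (R.Δ_sub hγ) hn
        obtain ⟨a1, a2, a3⟩ := bggTri_spec R M hM _ hK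
        simp only at a1 a2 a3
        have hP : bggP (γ :: K) = bggP M := by rw [bggP_cons, a3, bgg_mul_cancel]
        have hKΔ : ∀ a ∈ γ :: K, a ∈ R.Δ := by
          intro a ha
          rcases List.mem_cons.1 ha with rfl | ha
          · exact hγ
          · exact a1 a ha
        have := ih (γ :: K) hKΔ (by simp only [List.length_cons]; omega) f
        rw [hP, if_pos hMr] at this
        rw [← this, bgg_D_cons, bgg_dem_dem hγ0]
      · rw [if_neg hMr, bgg_dem_zero hγ0]

/-- The commutator (Chevalley) formula. -/
theorem bgg_chevalley (R : RootData n)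
    {w : EuclideanSpace ℝ (Fin n) ≃ₗ[ℝ] EuclideanSpace ℝ (Fin n)} (hw : w ∈ R.W) {r : ℕ}
    (hr : R.len w = r + 1) (χ : EuclideanSpace ℝ (Fin n))
    {f : MvPolynomial (Fin n) ℝ} (hf : f.IsHomogeneous r) :
    R.Aop w (toPoly χ * f) = ∑ β ∈ (bgg_pos_finite R).toFinset, bggG R w χ f β := by
  obtain ⟨L, hL, rfl⟩ := bgg_W_word R hw
  obtain ⟨M, h1, h2, h3, h4⟩ := bgg_Aop_spec R hL
  rw [h4, bgg_leibniz (bgg_simple_ne R h1), bgg_sum_eq R r (bgg_main R r) h1 (by omega)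
    (by rw [h2, h3]), h2, bgg_vanish R hf h1 (by omega), mul_zero, zero_add]

theorem bgg_covers_iff (R : RootData n)
    (w' w : EuclideanSpace ℝ (Fin n) ≃ₗ[ℝ] EuclideanSpace ℝ (Fin n))
    (α : EuclideanSpace ℝ (Fin n)) :
    R.Covers w' α w ↔ α ∈ R.pos ∧ w' = bggSr α * w ∧ R.len w = R.len w' + 1 := by
  have : w * w'⁻¹ = bggSr α ↔ w' = bggSr α * w := by
    constructor
    · intro h
      rw [← h]
      have h2 : bggSr α * w' = w := by rw [← h]; group
      have := bgg_mul_cancel α w'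
      rw [h2] at this
      rw [h, this]
    · rintro rfl
      rw [mul_inv_rev, bggSr_inv]; group
  rw [RootData.Covers, bgg_eq_sr, this]

theorem bgg_sr_mem_W (R : RootData n) {α} (hα : α ∈ R.pos) : bggSr α ∈ R.W :=
  Subgroup.subset_closure ⟨α, R.pos_sub hα, fun _ => rfl⟩

theorem bgg_cov_eq (R : RootData n)
    (w : EuclideanSpace ℝ (Fin n) ≃ₗ[ℝ] EuclideanSpace ℝ (Fin n)) :
    {q : (EuclideanSpace ℝ (Fin n) ≃ₗ[ℝ] EuclideanSpace ℝ (Fin n)) ×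
      EuclideanSpace ℝ (Fin n) | R.Covers q.1 q.2 w} =
    (fun β => (bggSr β * w, β)) ''
      {β | β ∈ R.pos ∧ R.len (bggSr β * w) + 1 = R.len w} := by
  ext ⟨u, α⟩
  simp only [Set.mem_ofPred_eq, bgg_covers_iff, Set.mem_image, Prod.mk.injEq]
  constructor
  · rintro ⟨h1, rfl, h3⟩
    exact ⟨α, ⟨h1, h3.symm⟩, rfl, rfl⟩
  · rintro ⟨β, ⟨h1, h2⟩, rfl, rfl⟩
    exact ⟨h1, rfl, h2.symm⟩

theorem bgg_cov_finite (R : RootData n)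
    (w : EuclideanSpace ℝ (Fin n) ≃ₗ[ℝ] EuclideanSpace ℝ (Fin n)) :
    {q : (EuclideanSpace ℝ (Fin n) ≃ₗ[ℝ] EuclideanSpace ℝ (Fin n)) ×
      EuclideanSpace ℝ (Fin n) | R.Covers q.1 q.2 w}.Finite := by
  rw [bgg_cov_eq]
  exact ((bgg_pos_finite R).subset (fun β hβ => hβ.1)).image _

theorem bgg_sum_cov (R : RootData n)
    (w : EuclideanSpace ℝ (Fin n) ≃ₗ[ℝ] EuclideanSpace ℝ (Fin n))
    (χ : EuclideanSpace ℝ (Fin n)) (f : MvPolynomial (Fin n) ℝ) :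
    ∑ β ∈ (bgg_pos_finite R).toFinset, bggG R w χ f β =
      ∑ᶠ q ∈ {q : (EuclideanSpace ℝ (Fin n) ≃ₗ[ℝ] EuclideanSpace ℝ (Fin n)) ×
        EuclideanSpace ℝ (Fin n) | R.Covers q.1 q.2 w},
        corootPair q.2 (q.1 χ) • R.Aop q.1 f := by
  rw [bgg_cov_eq, finsum_mem_image]
  · have hset : {β | β ∈ R.pos ∧ R.len (bggSr β * w) + 1 = R.len w} =
      ↑((bgg_pos_finite R).toFinset.filter (fun β => R.len (bggSr β * w) + 1 = R.len w)) := by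
      ext β; simp
    rw [hset, finsum_mem_coe_finset, Finset.sum_filter]
    rfl
  · intro a _ b _ h
    exact (Prod.ext_iff.1 h).2

/-! ### Chains -/

/-- The set of chains of length `s` ending at `w`. -/
def bggChains (R : RootData n) (s : ℕ)
    (w : EuclideanSpace ℝ (Fin n) ≃ₗ[ℝ] EuclideanSpace ℝ (Fin n)) :
    Set ((Fin s → EuclideanSpace ℝ (Fin n) ≃ₗ[ℝ] EuclideanSpace ℝ (Fin n)) ×
            (Fin s → EuclideanSpace ℝ (Fin n))) :=
  {p | ∀ i : Fin s, R.Covers (p.1 i) (p.2 i)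
            (if h : (i : ℕ) + 1 < s then p.1 ⟨(i : ℕ) + 1, h⟩ else w)}

/-- Appending the last step of a chain. -/
def bggSnoc {s : ℕ} (q : (EuclideanSpace ℝ (Fin n) ≃ₗ[ℝ] EuclideanSpace ℝ (Fin n)) ×
      EuclideanSpace ℝ (Fin n))
    (p : (Fin s → EuclideanSpace ℝ (Fin n) ≃ₗ[ℝ] EuclideanSpace ℝ (Fin n)) ×
            (Fin s → EuclideanSpace ℝ (Fin n))) :
    (Fin (s + 1) → EuclideanSpace ℝ (Fin n) ≃ₗ[ℝ] EuclideanSpace ℝ (Fin n)) ×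
            (Fin (s + 1) → EuclideanSpace ℝ (Fin n)) :=
  (Fin.snoc (α := fun _ => EuclideanSpace ℝ (Fin n) ≃ₗ[ℝ] EuclideanSpace ℝ (Fin n)) p.1 q.1,
   Fin.snoc (α := fun _ => EuclideanSpace ℝ (Fin n)) p.2 q.2)

theorem bgg_snoc_next {s : ℕ} {A : Type*} (x w : A) (p : Fin s → A) (i : Fin s) :
    (if h : (i.castSucc : ℕ) + 1 < s + 1 then
      (Fin.snoc (α := fun _ => A) p x) ⟨(i.castSucc : ℕ) + 1, h⟩ else w) =
    (if h : (i : ℕ) + 1 < s then p ⟨(i : ℕ) + 1, h⟩ else x) := by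
  have hi := i.2
  rw [dif_pos (by simp)]
  by_cases h : (i : ℕ) + 1 < s
  · rw [dif_pos h]
    simp [Fin.snoc, h]
  · rw [dif_neg h]
    simp [Fin.snoc, h]

theorem bgg_snoc_mem (R : RootData n) (s : ℕ)
    (w : EuclideanSpace ℝ (Fin n) ≃ₗ[ℝ] EuclideanSpace ℝ (Fin n))
    (q : (EuclideanSpace ℝ (Fin n) ≃ₗ[ℝ] EuclideanSpace ℝ (Fin n)) ×
      EuclideanSpace ℝ (Fin n))
    (p : (Fin s → EuclideanSpace ℝ (Fin n) ≃ₗ[ℝ] EuclideanSpace ℝ (Fin n)) ×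
            (Fin s → EuclideanSpace ℝ (Fin n))) :
    bggSnoc q p ∈ bggChains R (s + 1) w ↔ R.Covers q.1 q.2 w ∧ p ∈ bggChains R s q.1 := by
  unfold bggChains
  rw [Set.mem_ofPred_eq, Fin.forall_fin_succ', and_comm]
  apply and_congr
  · simp [bggSnoc]
  · rw [Set.mem_ofPred_eq]
    refine forall_congr' fun i => ?_
    have := bgg_snoc_next q.1 w p.1 i
    simp only [bggSnoc] at this ⊢
    rw [this, Fin.snoc_castSucc, Fin.snoc_castSucc]

theorem bgg_snoc_inj {s : ℕ} {q q' : (EuclideanSpace ℝ (Fin n) ≃ₗ[ℝ] EuclideanSpace ℝ (Fin n)) ×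
      EuclideanSpace ℝ (Fin n)}
    {p p' : (Fin s → EuclideanSpace ℝ (Fin n) ≃ₗ[ℝ] EuclideanSpace ℝ (Fin n)) ×
            (Fin s → EuclideanSpace ℝ (Fin n))} (h : bggSnoc q p = bggSnoc q' p') :
    q = q' ∧ p = p' := by
  obtain ⟨h1, h2⟩ := Prod.ext_iff.1 h
  obtain ⟨a1, a2⟩ := Fin.snoc_injective2 (α := fun _ =>
    EuclideanSpace ℝ (Fin n) ≃ₗ[ℝ] EuclideanSpace ℝ (Fin n)) h1
  obtain ⟨b1, b2⟩ := Fin.snoc_injective2 (α := fun _ =>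
    EuclideanSpace ℝ (Fin n)) h2
  exact ⟨Prod.ext a2 b2, Prod.ext a1 b1⟩

theorem bgg_chains_succ (R : RootData n) (s : ℕ)
    (w : EuclideanSpace ℝ (Fin n) ≃ₗ[ℝ] EuclideanSpace ℝ (Fin n)) :
    bggChains R (s + 1) w = ⋃ q ∈ {q : (EuclideanSpace ℝ (Fin n) ≃ₗ[ℝ] EuclideanSpace ℝ (Fin n)) ×
      EuclideanSpace ℝ (Fin n) | R.Covers q.1 q.2 w}, bggSnoc q '' bggChains R s q.1 := by
  ext P
  simp only [Set.mem_iUnion, Set.mem_image, Set.mem_ofPred_eq, exists_prop]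
  constructor
  · intro hP
    have e : bggSnoc (P.1 (Fin.last s), P.2 (Fin.last s))
        (fun i => P.1 i.castSucc, fun i => P.2 i.castSucc) = P := by
      apply Prod.ext
      · exact Fin.snoc_init_self P.1
      · exact Fin.snoc_init_self P.2
    have h := hP
    rw [← e, bgg_snoc_mem] at h
    exact ⟨_, h.1, _, h.2, e⟩
  · rintro ⟨q, hq, p, hp, rfl⟩
    exact (bgg_snoc_mem R s w q p).2 ⟨hq, hp⟩

theorem bgg_chains_finite (R : RootData n) (s : ℕ) :
    ∀ w : EuclideanSpace ℝ (Fin n) ≃ₗ[ℝ] EuclideanSpace ℝ (Fin n), (bggChains R s w).Finite := by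
  induction s with
  | zero => intro w; exact Set.toFinite _
  | succ s ih =>
    intro w
    rw [bgg_chains_succ]
    exact (bgg_cov_finite R w).biUnion fun q _ => (ih q.1).image _

theorem bgg_toPoly_homog (v : EuclideanSpace ℝ (Fin n)) : (toPoly v).IsHomogeneous 1 := by
  refine MvPolynomial.IsHomogeneous.sum _ _ _ fun i _ => ?_
  have := (MvPolynomial.isHomogeneous_C (Fin n) (v i)).mul (MvPolynomial.isHomogeneous_X ℝ i)
  simpa using this

theorem bgg_prod_homog {s d : ℕ} (χ : Fin s → EuclideanSpace ℝ (Fin n))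
    {σ : MvPolynomial (Fin n) ℝ} (hσ : σ.IsHomogeneous d) :
    ((∏ i, toPoly (χ i)) * σ).IsHomogeneous (s + d) := by
  have h := MvPolynomial.IsHomogeneous.prod Finset.univ (fun i => toPoly (χ i)) (fun _ => 1)
    (fun i _ => bgg_toPoly_homog (χ i))
  have := h.mul hσ
  simpa using this

theorem bgg_final (R : RootData n) (σ : MvPolynomial (Fin n) ℝ) (d : ℕ)
    (hσ : σ.IsHomogeneous d) (s : ℕ) :
    ∀ (w : EuclideanSpace ℝ (Fin n) ≃ₗ[ℝ] EuclideanSpace ℝ (Fin n)), w ∈ R.W →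
      R.len w = s + d → ∀ χ : Fin s → EuclideanSpace ℝ (Fin n),
      R.Aop w ((∏ i, toPoly (χ i)) * σ) =
      ∑ᶠ p ∈ bggChains R s w,
        (∏ i, corootPair (p.2 i) (p.1 i (χ i))) •
          R.Aop (if h : 0 < s then p.1 ⟨0, h⟩ else w) σ := by
  induction s with
  | zero =>
    intro w hw hlen χ
    have : bggChains R 0 w = {default} := by
      ext p
      simp [bggChains, eq_iff_true_of_subsingleton]
    rw [this, finsum_mem_singleton]
    simp
  | succ s ih =>
    intro w hw hlen χ
    have e : (∏ i, toPoly (χ i)) * σ = toPoly (χ (Fin.last s)) *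
        ((∏ i : Fin s, toPoly (χ i.castSucc)) * σ) := by
      rw [Fin.prod_univ_castSucc]; ring
    rw [e, bgg_chevalley R hw (r := s + d) (by omega) _
      (bgg_prod_homog (fun i : Fin s => χ i.castSucc) hσ), bgg_sum_cov, bgg_chains_succ,
      finsum_mem_biUnion]
    · refine finsum_mem_congr rfl fun q hq => ?_
      have hq' := (bgg_covers_iff R _ _ _).1 hq
      have hqW : q.1 ∈ R.W := by
        rw [hq'.2.1]; exact R.W.mul_mem (bgg_sr_mem_W R hq'.1) hw
      rw [ih q.1 hqW (by omega), finsum_mem_image (fun a _ b _ h => (bgg_snoc_inj h).2),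
        smul_finsum_mem (bgg_chains_finite R s q.1)]
      refine finsum_mem_congr rfl fun p hp => ?_
      rw [smul_smul, Fin.prod_univ_castSucc, mul_comm]
      have hA : (if h : 0 < s + 1 then (bggSnoc q p).1 ⟨0, h⟩ else w) =
          (if h : 0 < s then p.1 ⟨0, h⟩ else q.1) := by
        rcases s with _ | s
        · simp [bggSnoc, Fin.snoc]
        · simp [bggSnoc, Fin.snoc]
      rw [hA]
      congr 1
      simp [bggSnoc]
    · intro q _ q' _ hne
      rw [Function.onFun, Set.disjoint_left]
      rintro _ ⟨p, _, rfl⟩ ⟨p', _, h⟩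
      exact hne (bgg_snoc_inj h).1.symm
    · exact bgg_cov_finite R w
    · exact fun q _ => (bgg_chains_finite R s q.1).image _

end BGGAux

/-- for w ∈ W of length t, linear forms χ_1,…,χ_s (s ≤ t) and σ
homogeneous of degree t−s,
A_w(χ_1⋯χ_s·σ) = Σ over chains u_1 →_{β_1} u_2 →_{β_2} ⋯ u_s →_{β_s} w of
β̌_1(u_1(χ_1))⋯β̌_s(u_s(χ_s))·A_{u_1}(σ). -/
theorem bgg_integral_formula {n : ℕ} (R : RootData n)
    (w : EuclideanSpace ℝ (Fin n) ≃ₗ[ℝ] EuclideanSpace ℝ (Fin n)) (hw : w ∈ R.W)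
    (t : ℕ) (ht : R.len w = t) (s : ℕ) (hs : s ≤ t)
    (χ : Fin s → EuclideanSpace ℝ (Fin n))
    (σ : MvPolynomial (Fin n) ℝ) (hσ : σ.IsHomogeneous (t - s)) :
    R.Aop w ((∏ i, toPoly (χ i)) * σ) =
      ∑ᶠ p ∈ {p : (Fin s → EuclideanSpace ℝ (Fin n) ≃ₗ[ℝ] EuclideanSpace ℝ (Fin n)) ×
            (Fin s → EuclideanSpace ℝ (Fin n)) |
          ∀ i : Fin s, R.Covers (p.1 i) (p.2 i)
            (if h : (i : ℕ) + 1 < s then p.1 ⟨(i : ℕ) + 1, h⟩ else w)},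
        (∏ i, corootPair (p.2 i) (p.1 i (χ i))) •
          R.Aop (if h : 0 < s then p.1 ⟨0, h⟩ else w) σ := by
  exact bgg_final R σ (t - s) hσ s w hw (by omega) χ
end
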